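/- arXiv:math/0607528 — 3 statements merged into one kernel-verified Lean document; each statement's English description precedes it below -/
import Mathlib

section
/- Every non-spherical Pride group based on a complete graph with at least 5 vertices contains a non-abelian free subgroup. -/
open Monoid

section PrideDefs

variable {A B : Type*} [Group A] [Group B]

/-- The free product length of an element of `A ∗ B`: the least number of
letters (each from `A` or `B`) whose product is `x`.  For a nontrivial element
this is the number of syllables in its normal form. -/
noncomputable def fpLength (x : Coprod A B) : ℕ :=
  sInf {n | ∃ l : List (Coprod A B), l.length = n ∧ l.prod = x ∧
      ∀ w ∈ l, (∃ a : A, Coprod.inl a = w) ∨ (∃ b : B, Coprod.inr b = w)}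

/-- An element of `A ∗ B` is cyclically reduced iff its free product length is minimal
in its conjugacy class. -/
def IsCyclicallyReduced (x : Coprod A B) : Prop :=
  ∀ g : Coprod A B, fpLength x ≤ fpLength (g * x * g⁻¹)

/-- The minimal free product length of a nontrivial element of `N` (junk value `0`
if `N` is trivial). -/
noncomputable def minRelLength (N : Subgroup (Coprod A B)) : ℕ :=
  sInf (fpLength '' {x | x ∈ N ∧ x ≠ 1})

/-- The Gersten–Stallings angle determined by a normal subgroup `N` of `A ∗ B`:
`2π/m` where `m` is the minimal free product length of a nontrivial element of `N`,
and `0` if `N` is trivial. -/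
noncomputable def gsAngle (N : Subgroup (Coprod A B)) : ℝ :=
  letI := Classical.propDecidable (∃ x ∈ N, x ≠ 1)
  if ∃ x ∈ N, x ≠ 1 then 2 * Real.pi / (minRelLength N : ℝ) else 0

variable {I : Type*} (G : I → Type*) [∀ i, Group (G i)]

/-- The canonical homomorphism `G i ∗ G j →* ∗ₖ G k`. -/
def edgeEmb (i j : I) : Coprod (G i) (G j) →* CoprodI G :=
  Coprod.lift CoprodI.of CoprodI.of

/-- The set of all Pride relators inside the free product of the vertex groups. -/
def prideRels (R : ∀ i j : I, Set (Coprod (G i) (G j))) : Set (CoprodI G) :=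
  ⋃ (i : I) (j : I), (edgeEmb G i j) '' (R i j)

/-- The Pride group based on the complete graph on `I` with vertex groups `G i` and
edge relations `R i j`. -/
abbrev PrideGroup (R : ∀ i j : I, Set (Coprod (G i) (G j))) : Type _ :=
  CoprodI G ⧸ Subgroup.normalClosure (prideRels G R)

/-- The conditions on the defining data of a Pride group: no relations on loops,
the relation sets are symmetric in the two vertices of an edge, each relation set is
finite, and each relator is cyclically reduced of free product length at least `2`. -/
def IsPrideData (R : ∀ i j : I, Set (Coprod (G i) (G j))) : Prop :=
  (∀ i, R i i = ∅) ∧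
  (∀ i j, (Coprod.swap (G i) (G j)) '' R i j = R j i) ∧
  (∀ i j, (R i j).Finite) ∧
  (∀ i j, ∀ w ∈ R i j, IsCyclicallyReduced w ∧ 2 ≤ fpLength w)

/-- Non-sphericity: all Gersten-Stallings angles are at most `π/2` and the angle sum
of each triangle is at most `π`. -/
def NonSpherical (R : ∀ i j : I, Set (Coprod (G i) (G j))) : Prop :=
  (∀ i j : I, i ≠ j → gsAngle (Subgroup.normalClosure (R i j)) ≤ Real.pi / 2) ∧
  (∀ i j k : I, i ≠ j → j ≠ k → i ≠ k →
    gsAngle (Subgroup.normalClosure (R i j)) + gsAngle (Subgroup.normalClosure (R j k)) +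
      gsAngle (Subgroup.normalClosure (R i k)) ≤ Real.pi)

end PrideDefs

/-! ### The numbers game -/

namespace NumbersGame

variable {I : Type*}

open Classical in
/-- Firing the vertex `i` in a position `μ` of the numbers game with weights `c`. -/
noncomputable def fire (c : I → I → ℝ) (i : I) (μ : I → ℝ) : I → ℝ :=
  fun j => if j = i then -μ i else μ j + c i j * μ i

section Fire

variable (c : I → I → ℝ)

@[simp] theorem fire_same (i : I) (μ : I → ℝ) : fire c i μ i = -μ i := by simp [fire]

theorem fire_ne {i j : I} (h : j ≠ i) (μ : I → ℝ) : fire c i μ j = μ j + c i j * μ i := by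
  simp [fire, h]

@[simp] theorem fire_fire (i : I) (μ : I → ℝ) : fire c i (fire c i μ) = μ := by
  funext j
  by_cases h : j = i
  · subst h; simp
  · simp [fire_ne c h]

/-- Alternate firings of `i` and `l`, `t` of them in total, the last one at `i`. -/
noncomputable def alt : ℕ → I → I → (I → ℝ) → I → ℝ
  | 0, _, _, ν => ν
  | t + 1, i, l, ν => fire c i (alt t l i ν)

@[simp] theorem alt_zero (i l : I) (ν : I → ℝ) : alt c 0 i l ν = ν := rfl

theorem alt_succ (t : ℕ) (i l : I) (ν : I → ℝ) :
    alt c (t + 1) i l ν = fire c i (alt c t l i ν) := rfl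

/-- Positions reachable in `n` legal moves from the all-ones position. -/
inductive Reach : ℕ → (I → ℝ) → Prop
  | zero : Reach 0 fun _ => 1
  | step {n : ℕ} {μ : I → ℝ} {i : I} : Reach n μ → 0 < μ i → Reach (n + 1) (fire c i μ)

end Fire

/-- The weight attached to a label; the label `0` stands for `∞`. -/
noncomputable def weight : ℕ → ℝ
  | 2 => 0
  | 3 => 1
  | 4 => √2
  | 6 => √3
  | _ => 2

/-- Symmetric crystallographic labels (`0` standing for `∞`) without spherical triples. -/
structure IsLabelling (k : I → I → ℕ) : Prop where
  symm : ∀ i j, k i j = k j i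
  values : ∀ i j, i ≠ j → k i j = 0 ∨ k i j = 2 ∨ k i j = 3 ∨ k i j = 4 ∨ k i j = 6
  triple : ∀ i j l, i ≠ j → j ≠ l → i ≠ l →
    (1 / k i j + 1 / k j l + 1 / k i l : ℚ) ≤ 1

theorem weight_zero : weight 0 = 2 := rfl
theorem weight_two : weight 2 = 0 := rfl
theorem weight_three : weight 3 = 1 := rfl
theorem weight_four : weight 4 = √2 := rfl
theorem weight_six : weight 6 = √3 := rfl

theorem sqrt_two_bounds : (7 / 5 : ℝ) ≤ √2 ∧ √2 ≤ 3 / 2 ∧ √2 * √2 = 2 := by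
  refine ⟨Real.le_sqrt_of_sq_le (by norm_num), ?_, Real.mul_self_sqrt (by norm_num)⟩
  rw [Real.sqrt_le_left (by norm_num)]; norm_num

theorem sqrt_three_bounds : (17 / 10 : ℝ) ≤ √3 ∧ √3 ≤ 2 ∧ √3 * √3 = 3 := by
  refine ⟨Real.le_sqrt_of_sq_le (by norm_num), ?_, Real.mul_self_sqrt (by norm_num)⟩
  rw [Real.sqrt_le_left (by norm_num)]; norm_num

theorem weight_nonneg (n : ℕ) : 0 ≤ weight n := by
  unfold weight; split <;> positivity

section Game

variable {k : I → I → ℕ}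

/-- The weights of a labelling. -/
noncomputable def wt (k : I → I → ℕ) (i j : I) : ℝ := weight (k i j)

theorem wt_nonneg (i j : I) : 0 ≤ wt k i j := weight_nonneg _

theorem wt_comm (hk : IsLabelling k) (i j : I) : wt k i j = wt k j i := by rw [wt, wt, hk.symm]

theorem reach_pair_pos (hk : IsLabelling k) {i j : I} (hij : i ≠ j) (h0 : k i j = 0) {n : ℕ} {μ
    : I → ℝ}
    (h : Reach (wt k) n μ) : 0 < μ i + μ j := by
  have h1 : wt k i j = 2 := by rw [wt, h0, weight_zero]
  have h2 : wt k j i = 2 := by rw [wt_comm hk, h1]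
  induction h with
  | zero => norm_num
  | @step n μ l hμ hl ih =>
    by_cases hi : i = l
    · subst hi; rw [fire_same, fire_ne _ hij.symm, h1]; linarith
    by_cases hj : j = l
    · subst hj; rw [fire_same, fire_ne _ hij, h2]; linarith
    rw [fire_ne _ hi, fire_ne _ hj]
    have := mul_nonneg (wt_nonneg (k := k) l i) hl.le
    have := mul_nonneg (wt_nonneg (k := k) l j) hl.le
    linarith

theorem reach_triple_pos (hk : IsLabelling k) {i j l : I} (hij : i ≠ j) (hjl : j ≠ l) (hil
    : i ≠ l) {x y z : ℝ}
    (hx : 0 < x) (hy : 0 < y) (hz : 0 < z) (h1 : 2 * x ≤ wt k i j * y + wt k i l * z)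
    (h2 : 2 * y ≤ wt k i j * x + wt k j l * z) (h3 : 2 * z ≤ wt k i l * x + wt k j l * y)
    {n : ℕ} {μ : I → ℝ} (h : Reach (wt k) n μ) : 0 < x * μ i + y * μ j + z * μ l := by
  induction h with
  | zero => linarith
  | @step n μ m hμ hm ih =>
    by_cases hi : i = m
    · subst hi; rw [fire_same, fire_ne _ hij.symm, fire_ne _ hil.symm]
      nlinarith [mul_le_mul_of_nonneg_right h1 hm.le]
    by_cases hj : j = m
    · subst hj; rw [fire_same, fire_ne _ hij, fire_ne _ hjl.symm, wt_comm hk j i]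
      nlinarith [mul_le_mul_of_nonneg_right h2 hm.le]
    by_cases hl : l = m
    · subst hl; rw [fire_same, fire_ne _ hil, fire_ne _ hjl, wt_comm hk l i, wt_comm hk l j]
      nlinarith [mul_le_mul_of_nonneg_right h3 hm.le]
    rw [fire_ne _ hi, fire_ne _ hj, fire_ne _ hl]
    have := mul_nonneg hx.le (mul_nonneg (wt_nonneg (k := k) m i) hm.le)
    have := mul_nonneg hy.le (mul_nonneg (wt_nonneg (k := k) m j) hm.le)
    have := mul_nonneg hz.le (mul_nonneg (wt_nonneg (k := k) m l) hm.le)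
    linarith

theorem not_neg_of_label_two (hk : IsLabelling k) {i j l : I} (hij : i ≠ j) (hjl : j ≠ l) (hil
    : i ≠ l)
    (h2 : k i j = 2) {n : ℕ} {μ : I → ℝ} (h : Reach (wt k) n μ) (hi : μ i < 0) (hj : μ j < 0) :
    0 ≤ μ l := by
  by_contra! hl
  obtain ⟨a1, -, a3⟩ := sqrt_two_bounds
  obtain ⟨b1, -, b3⟩ := sqrt_three_bounds
  have key := hk.triple i j l hij hjl hil
  have tri := fun x y z hx hy hz =>
    @reach_triple_pos I k hk i j l hij hjl hil x y z hx hy hz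
  rw [h2] at key
  have e0 : wt k i j = 0 := by rw [wt, h2, weight_two]
  suffices H : ∃ x y z : ℝ, 0 < x ∧ 0 < y ∧ 0 < z ∧ 2 * x ≤ wt k i l * z ∧
      2 * y ≤ wt k j l * z ∧ 2 * z ≤ wt k i l * x + wt k j l * y by
    obtain ⟨x, y, z, hx, hy, hz, e1, e2, e3⟩ := H
    have := tri x y z hx hy hz (by rw [e0]; linarith) (by rw [e0]; linarith) e3 h
    nlinarith
  have pos := fun (a b : I) (hab : a ≠ b) (h0 : k a b = 0) => reach_pair_pos hk hab h0 h
  rcases hk.values i l hil with h1 | h1 | h1 | h1 | h1 <;>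
  rcases hk.values j l hjl with h3 | h3 | h3 | h3 | h3 <;>
  first
  | (have := pos i l hil h1; linarith)
  | (have := pos j l hjl h3; linarith)
  | (exfalso; rw [h1, h3] at key; norm_num at key; done)
  | (simp only [wt, h1, h3, weight_three, weight_four, weight_six]
     first
     | (refine ⟨1, 1, √2, one_pos, one_pos, by positivity, ?_, ?_, ?_⟩ <;> nlinarith)
     | (refine ⟨1, √3, 2, one_pos, by positivity, two_pos, ?_, ?_, ?_⟩ <;> nlinarith)
     | (refine ⟨√3, 1, 2, by positivity, one_pos, two_pos, ?_, ?_, ?_⟩ <;> nlinarith))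

theorem reach_not_three_neg (hk : IsLabelling k) {i j l : I} (hij : i ≠ j) (hjl : j ≠ l) (hil
    : i ≠ l)
    {n : ℕ} {μ : I → ℝ} (h : Reach (wt k) n μ) (hi : μ i < 0) (hj : μ j < 0) : 0 ≤ μ l := by
  by_contra! hl
  have pos := fun (a b : I) (hab : a ≠ b) (h0 : k a b = 0) => reach_pair_pos hk hab h0 h
  by_cases e1 : k i j = 2
  · exact absurd hl (not_lt.2 (not_neg_of_label_two hk hij hjl hil e1 h hi hj))
  by_cases e2 : k j l = 2
  · exact absurd hi (not_lt.2 (not_neg_of_label_two hk hjl hil.symm hij.symm e2 h hj hl))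
  by_cases e3 : k i l = 2
  · exact absurd hj (not_lt.2 (not_neg_of_label_two hk hil hjl.symm hij e3 h hi hl))
  have one_le : ∀ a b, a ≠ b → k a b ≠ 2 → 1 ≤ wt k a b := by
    intro a b hab h2
    obtain ⟨a1, -, a3⟩ := sqrt_two_bounds
    obtain ⟨b1, -, b3⟩ := sqrt_three_bounds
    rcases hk.values a b hab with h | h | h | h | h <;>
      simp only [wt, h, weight_zero, weight_three, weight_four, weight_six] <;>
        first | omega | linarith
  have a1 := one_le i j hij e1
  have a2 := one_le j l hjl e2
  have a3 := one_le i l hil e3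
  have := reach_triple_pos hk hij hjl hil one_pos one_pos one_pos (by linarith) (by linarith)
    (by linarith) h
  linarith

theorem alt_next_pos (hk : IsLabelling k) {i l : I} (hil : i ≠ l) {t : ℕ} (ht : t < k i l) {ν
    : I → ℝ}
    (hi : 0 < ν i) (hl : 0 < ν l) : 0 < alt (wt k) t i l ν l := by
  have hli := hil.symm
  obtain ⟨a1, -, a3⟩ := sqrt_two_bounds
  obtain ⟨b1, -, b3⟩ := sqrt_three_bounds
  have hc : wt k l i = wt k i l := wt_comm hk l i
  generalize hx : ν i = x at *
  generalize hy : ν l = y at *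
  rcases hk.values i l hil with h | h | h | h | h
  · omega
  · have hw : wt k i l = 0 := by rw [wt, h, weight_two]
    rw [h] at ht
    interval_cases t <;>
      simp only [alt_succ, alt_zero, fire_same, fire_ne _ hil, fire_ne _ hli, hc, hw, hx, hy] <;>
      linarith
  · have hw : wt k i l = 1 := by rw [wt, h, weight_three]
    rw [h] at ht
    interval_cases t <;>
      simp only [alt_succ, alt_zero, fire_same, fire_ne _ hil, fire_ne _ hli, hc, hw, hx, hy] <;>
      linarith
  · have hw : wt k i l = √2 := by rw [wt, h, weight_four]
    rw [h] at ht
    have p1 := mul_pos (show 0 < √2 by linarith) hi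
    have p2 := mul_pos (show 0 < √2 by linarith) hl
    generalize √2 = r at *
    interval_cases t <;>
      simp only [alt_succ, alt_zero, fire_same, fire_ne _ hil, fire_ne _ hli, hc, hw, hx, hy]
    · exact hl
    · linarith
    · refine lt_of_lt_of_eq (add_pos hl p1) ?_; grind
    · refine lt_of_lt_of_eq hl ?_; grind
  · have hw : wt k i l = √3 := by rw [wt, h, weight_six]
    rw [h] at ht
    have p1 := mul_pos (show 0 < √3 by linarith) hi
    have p2 := mul_pos (show 0 < √3 by linarith) hl
    generalize √3 = r at *
    interval_cases t <;>
      simp only [alt_succ, alt_zero, fire_same, fire_ne _ hil, fire_ne _ hli, hc, hw, hx, hy]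
    · exact hl
    · linarith
    · refine lt_of_lt_of_eq (show 0 < 2 * y + r * x by linarith) ?_; grind
    · refine lt_of_lt_of_eq (show 0 < 2 * y + r * x by linarith) ?_; grind
    · refine lt_of_lt_of_eq (show 0 < y + r * x by linarith) ?_; grind
    · refine lt_of_lt_of_eq hl ?_; grind

theorem alt_label (hk : IsLabelling k) {i l : I} (hil : i ≠ l) (h0 : k i l ≠ 0) (ν : I → ℝ) :
    alt (wt k) (k i l) i l ν = alt (wt k) (k i l) l i ν := by
  have hli := hil.symm
  obtain ⟨-, -, a3⟩ := sqrt_two_bounds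
  obtain ⟨-, -, b3⟩ := sqrt_three_bounds
  have hc : wt k l i = wt k i l := wt_comm hk l i
  funext j
  have hcases : j = i ∨ j = l ∨ (j ≠ i ∧ j ≠ l) := by tauto
  rcases hk.values i l hil with h | h | h | h | h
  · exact absurd h h0
  · have hw : wt k i l = 0 := by rw [wt, h, weight_two]
    rw [h]
    rcases hcases with rfl | rfl | ⟨h1, h2⟩ <;>
      simp only [alt_succ, alt_zero, fire_same, fire_ne _ hil, fire_ne _ hli, hc, hw, *,
        fire_ne, ne_eq, not_false_eq_true] <;> ring
  · have hw : wt k i l = 1 := by rw [wt, h, weight_three]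
    rw [h]
    rcases hcases with rfl | rfl | ⟨h1, h2⟩ <;>
      simp only [alt_succ, alt_zero, fire_same, fire_ne _ hil, fire_ne _ hli, hc, hw, *,
        fire_ne, ne_eq, not_false_eq_true] <;> ring
  · have hw : wt k i l = √2 := by rw [wt, h, weight_four]
    rw [h]
    rcases hcases with rfl | rfl | ⟨h1, h2⟩ <;>
      simp only [alt_succ, alt_zero, fire_same, fire_ne _ hil, fire_ne _ hli, hc, hw, *,
        fire_ne, ne_eq, not_false_eq_true] <;> generalize √2 = r at * <;> clear b3 hw hc h <;>
      grind
  · have hw : wt k i l = √3 := by rw [wt, h, weight_six]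
    rw [h]
    rcases hcases with rfl | rfl | ⟨h1, h2⟩ <;>
      simp only [alt_succ, alt_zero, fire_same, fire_ne _ hil, fire_ne _ hli, hc, hw, *,
        fire_ne, ne_eq, not_false_eq_true] <;> generalize √3 = r at * <;> clear a3 hw hc h <;>
      grind

end Game

end NumbersGame

namespace NumbersGame

variable {I : Type*}

section Game

variable {k : I → I → ℕ}

theorem reach_alt (hk : IsLabelling k) {i l : I} (hil : i ≠ l) {m : ℕ} {ν : I → ℝ} (hν : Reach
    (wt k) m ν)
    (hi : 0 < ν i) (hl : 0 < ν l) :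
    ∀ {t : ℕ}, t ≤ k i l →
      Reach (wt k) (m + t) (alt (wt k) t i l ν) ∧ Reach (wt k) (m + t) (alt (wt k) t l i ν)
  | 0, _ => ⟨hν, hν⟩
  | t + 1, ht => by
    obtain ⟨h1, h2⟩ := reach_alt hk hil hν hi hl (t := t) (by omega)
    exact ⟨h2.step (alt_next_pos hk hil.symm (by rw [hk.symm]; omega) hl hi),
      h1.step (alt_next_pos hk hil (by omega) hi hl)⟩

theorem alt_last_neg (hk : IsLabelling k) {i l : I} (hil : i ≠ l) {ν : I → ℝ} (hi : 0 < ν i) (hl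
    : 0 < ν l) {t : ℕ}
    (h0 : 0 < t) (ht : t ≤ k i l) : alt (wt k) t i l ν i < 0 := by
  obtain ⟨t, rfl⟩ := Nat.exists_eq_succ_of_ne_zero h0.ne'
  rw [alt_succ, fire_same]
  have := alt_next_pos hk hil.symm (t := t) (by rw [hk.symm]; omega) hl hi
  linarith

/-- Coordinates are nonzero, and firing a negative coordinate undoes a legal move. -/
def IsGood (k : I → I → ℕ) (n : ℕ) : Prop :=
  ∀ μ, Reach (wt k) n μ → ∀ i, μ i ≠ 0 ∧
    (μ i < 0 → ∃ m, n = m + 1 ∧ Reach (wt k) m (fire (wt k) i μ))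

theorem exists_alt_of_good (hk : IsLabelling k) {i l : I} (hil : i ≠ l) (h0 : k i l ≠ 0) (n : ℕ) :
    (∀ m ≤ n, IsGood k m) → ∀ {μ : I → ℝ}, Reach (wt k) n μ →
    ∃ t ν m, t ≤ k i l ∧ n = m + t ∧ Reach (wt k) m ν ∧ 0 < ν i ∧ 0 < ν l ∧
      (μ = alt (wt k) t i l ν ∨ μ = alt (wt k) t l i ν) := by
  induction n using Nat.strong_induction_on with
  | _ n ih =>
  intro hgood μ hμ
  have main : ∀ i l : I, i ≠ l → k i l ≠ 0 → μ i < 0 →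
      (∀ m < n, ∀ {μ : I → ℝ}, Reach (wt k) m μ →
        ∃ t ν m', t ≤ k i l ∧ m = m' + t ∧ Reach (wt k) m' ν ∧ 0 < ν i ∧ 0 < ν l ∧
        (μ = alt (wt k) t i l ν ∨ μ = alt (wt k) t l i ν)) →
      ∃ t ν m, t ≤ k i l ∧ n = m + t ∧ Reach (wt k) m ν ∧ 0 < ν i ∧ 0 < ν l ∧
        (μ = alt (wt k) t i l ν ∨ μ = alt (wt k) t l i ν) := by
    intro i l hil h0 hi ih
    obtain ⟨m, rfl, hm⟩ := ((hgood n le_rfl) μ hμ i).2 hi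
    have hpos : 0 < fire (wt k) i μ i := by rw [fire_same]; linarith
    obtain ⟨t, ν, m', ht, rfl, hν, hνi, hνl, h⟩ := ih m (Nat.lt_succ_self m) hm
    have hμ' : ∀ ρ, fire (wt k) i μ = ρ → μ = fire (wt k) i ρ := by
      rintro ρ rfl; rw [fire_fire]
    have contra : 0 < t → fire (wt k) i μ ≠ alt (wt k) t i l ν := by
      intro h1 h2
      rw [h2] at hpos
      exact absurd (alt_last_neg hk hil hνi hνl h1 ht) (not_lt.2 hpos.le)
    rcases h with h | h
    · rcases Nat.eq_zero_or_pos t with rfl | h1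
      · exact ⟨1, ν, m', Nat.one_le_iff_ne_zero.2 h0, rfl, hν, hνi, hνl, Or.inl (hμ' _ h)⟩
      · exact absurd h (contra h1)
    · rcases lt_or_eq_of_le ht with h1 | rfl
      · exact ⟨t + 1, ν, m', h1, rfl, hν, hνi, hνl, Or.inl (hμ' _ h)⟩
      · rw [← alt_label hk hil h0] at h
        exact absurd h (contra (Nat.pos_of_ne_zero h0))
  rcases lt_or_gt_of_ne (hgood n le_rfl μ hμ i).1 with hi | hi
  · exact main i l hil h0 hi fun m hm μ hμ => ih m hm (fun m' h => hgood m' (by omega)) hμ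
  rcases lt_or_gt_of_ne (hgood n le_rfl μ hμ l).1 with hl | hl
  · have := main l i hil.symm (by rwa [hk.symm]) hl fun m hm μ hμ => by
      obtain ⟨t, ν, m', h1, h2, h3, h4, h5, h6⟩ :=
        ih m hm (fun m' h => hgood m' (by omega)) hμ
      exact ⟨t, ν, m', hk.symm i l ▸ h1, h2, h3, h5, h4, h6.symm⟩
    obtain ⟨t, ν, m', h1, h2, h3, h4, h5, h6⟩ := this
    exact ⟨t, ν, m', hk.symm i l ▸ h1, h2, h3, h5, h4, h6.symm⟩
  · exact ⟨0, μ, n, Nat.zero_le _, rfl, hμ, hi, hl, Or.inl rfl⟩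

theorem isGood (hk : IsLabelling k) (n : ℕ) : IsGood k n := by
  induction n using Nat.strong_induction_on with
  | _ n ih =>
  intro μ hμ i
  cases hμ with
  | zero => exact ⟨one_ne_zero, fun h => absurd h (by norm_num)⟩
  | @step n μ l hμ hl =>
    by_cases hil : i = l
    · subst hil
      rw [fire_same, fire_fire]
      exact ⟨by linarith, fun _ => ⟨n, rfl, hμ⟩⟩
    by_cases h0 : k i l = 0
    · have h1 := reach_pair_pos hk hil h0 hμ
      have h2 : wt k l i = 2 := by rw [wt_comm hk, wt, h0, weight_zero]
      have h3 : 0 < fire (wt k) l μ i := by rw [fire_ne _ hil, h2]; linarith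
      exact ⟨h3.ne', fun h => absurd h (not_lt.2 h3.le)⟩
    obtain ⟨t, ν, m, ht, rfl, hν, hνi, hνl, h⟩ :=
      exists_alt_of_good hk hil h0 n (fun m hm => ih m (by omega)) hμ
    have contra : 0 < t → μ ≠ alt (wt k) t l i ν := by
      intro h1 h2
      rw [h2] at hl
      exact absurd (alt_last_neg hk (Ne.symm hil) hνl hνi h1 (by rwa [hk.symm]))
        (not_lt.2 hl.le)
    have h' : μ = alt (wt k) t i l ν := by
      rcases h with h | h
      · exact h
      · rcases Nat.eq_zero_or_pos t with rfl | h1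
        · exact h
        · exact absurd h (contra h1)
    have ht' : t < k i l := by
      refine lt_of_le_of_ne ht ?_
      rintro rfl
      exact contra (Nat.pos_of_ne_zero h0) (h'.trans (alt_label hk hil h0 ν))
    have e : fire (wt k) l μ = alt (wt k) (t + 1) l i ν := by rw [alt_succ, h']
    rcases lt_or_eq_of_le (Nat.succ_le_of_lt ht') with h1 | h1
    · have h3 : 0 < fire (wt k) l μ i := by
        rw [e]; exact alt_next_pos hk (Ne.symm hil) (by rw [hk.symm]; exact h1) hνl hνi
      exact ⟨h3.ne', fun h => absurd h (not_lt.2 h3.le)⟩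
    · have h1' : t + 1 = k i l := h1
      have e' : fire (wt k) l μ = alt (wt k) (t + 1) i l ν := by
        rw [e, h1', alt_label hk hil h0]
      refine ⟨?_, fun _ => ⟨m + t, rfl, ?_⟩⟩
      · rw [e']; exact (alt_last_neg hk hil hνi hνl t.succ_pos h1.le).ne
      · rw [e', alt_succ, fire_fire]
        exact (reach_alt hk hil hν hνi hνl ht).2

theorem reach_unique (hk : IsLabelling k) {n m : ℕ} {μ : I → ℝ} (hn : Reach (wt k) n μ) (hm
    : Reach (wt k) m μ) :
    n = m := by
  induction hn generalizing m with
  | zero =>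
    cases hm' : m with
    | zero => rfl
    | succ m =>
      exfalso
      subst hm'
      generalize hμ : (fun _ : I => (1 : ℝ)) = μ at hm
      cases hm with
      | @step _ μ i _ hi =>
        have := congrFun hμ i
        rw [fire_same] at this
        linarith
  | @step n μ i hμ hi ih =>
    obtain ⟨m', rfl, h⟩ := (isGood hk m _ hm i).2 (by rw [fire_same]; linarith)
    rw [fire_fire] at h
    rw [ih h]

theorem exists_alt (hk : IsLabelling k) {i l : I} (hil : i ≠ l) (h0 : k i l ≠ 0) {n : ℕ} {μ : I → ℝ}
    (hμ : Reach (wt k) n μ) :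
    ∃ t ν m, t ≤ k i l ∧ n = m + t ∧ Reach (wt k) m ν ∧ 0 < ν i ∧ 0 < ν l ∧
      (μ = alt (wt k) t i l ν ∨ μ = alt (wt k) t l i ν) :=
  exists_alt_of_good hk hil h0 n (fun m _ => isGood hk m) hμ

end Game

end NumbersGame

/-! ### Abstract chamber games -/

/-- `u` is obtained from `v` by moves of types `i` and `j`. -/
def Orb {I V : Type*} (s : I → V → V) (i j : I) : V → V → Prop :=
  Relation.ReflTransGen fun a b => b = s i a ∨ b = s j a

/-- A ranked set of states with involutive moves that behaves like the set of elements of a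
Coxeter group without finite triples; `k i j = 0` stands for `∞`. -/
structure ChamberGame (I : Type*) where
  /-- states -/
  V : Type*
  /-- moves -/
  s : I → V → V
  /-- rank -/
  rk : V → ℕ
  /-- descents -/
  neg : I → V → Prop
  /-- labels -/
  k : I → I → ℕ
  s_s : ∀ i v, s i (s i v) = v
  neg_s : ∀ i v, neg i (s i v) ↔ ¬ neg i v
  rk_s : ∀ i v, ¬ neg i v → rk (s i v) = rk v + 1
  k_symm : ∀ i j, k i j = k j i
  not_three : ∀ i j l v, i ≠ j → j ≠ l → i ≠ l → neg i v → neg j v → ¬ neg l v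
  k_ne_zero : ∀ i j w, i ≠ j → neg i w → neg j w → k i j ≠ 0
  top : ∀ i j w u, i ≠ j → neg i w → neg j w → Orb s i j w u →
    u = w ∨ (¬ (neg i u ∧ neg j u) ∧ rk u < rk w)
  bot : ∀ i j w u, i ≠ j → neg i w → neg j w → Orb s i j w u → rk w ≤ rk u + k i j
  exists_top : ∀ i j v, i ≠ j → k i j ≠ 0 → ∃ w, Orb s i j w v ∧ neg i w ∧ neg j w

namespace NumbersGame

variable {I : Type*} {k : I → I → ℕ}

/-- Reachable positions. -/
abbrev Pos (k : I → I → ℕ) : Type _ := {μ : I → ℝ // ∃ n, Reach (wt k) n μ}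

namespace Pos

/-- The number of moves leading to a position. -/
noncomputable def rk (v : Pos k) : ℕ := v.2.choose

theorem reach (v : Pos k) : Reach (wt k) v.rk v.1 := v.2.choose_spec

theorem rk_eq (hk : IsLabelling k) {v : Pos k} {n : ℕ} (h : Reach (wt k) n v.1) : v.rk = n :=
  reach_unique hk v.reach h

theorem exists_reach_fire (hk : IsLabelling k) (i : I) (v : Pos k) : ∃ n, Reach (wt k) n (fire
    (wt k) i v.1) := by
  obtain ⟨h1, h2⟩ := isGood hk _ _ v.reach i
  rcases lt_or_gt_of_ne h1 with h | h
  · obtain ⟨m, -, hm⟩ := h2 h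
    exact ⟨m, hm⟩
  · exact ⟨_, v.reach.step h⟩

/-- Firing as a self-map of the reachable positions. -/
noncomputable def move (hk : IsLabelling k) (i : I) (v : Pos k) : Pos k :=
  ⟨fire (wt k) i v.1, exists_reach_fire hk i v⟩

theorem orb_alt (hk : IsLabelling k) {i j : I} (hij : i ≠ j) (h0 : k i j ≠ 0) {v : Pos k}
    {ν : I → ℝ} {m : ℕ} (hν : Reach (wt k) m ν) (hi : 0 < ν i) (hj : 0 < ν j)
    (hv : ∃ t ≤ k i j, v.1 = alt (wt k) t i j ν ∨ v.1 = alt (wt k) t j i ν) {u : Pos k}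
    (h : Orb (move hk) i j v u) :
    ∃ t ≤ k i j, u.1 = alt (wt k) t i j ν ∨ u.1 = alt (wt k) t j i ν := by
  have main : ∀ i j : I, i ≠ j → k i j ≠ 0 → ∀ t ≤ k i j, ∀ μ : I → ℝ,
      (μ = alt (wt k) t i j ν ∨ μ = alt (wt k) t j i ν) →
      ∃ t ≤ k i j, fire (wt k) i μ = alt (wt k) t i j ν ∨
        fire (wt k) i μ = alt (wt k) t j i ν := by
    intro i j hij h0 t ht μ h
    have key : ∀ t ≤ k i j, μ = alt (wt k) t i j ν → ∃ t ≤ k i j,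
        fire (wt k) i μ = alt (wt k) t i j ν ∨ fire (wt k) i μ = alt (wt k) t j i ν := by
      rintro (_ | t) ht rfl
      · exact ⟨1, Nat.one_le_iff_ne_zero.2 h0, Or.inl rfl⟩
      · exact ⟨t, by omega, Or.inr (by rw [alt_succ, fire_fire])⟩
    rcases h with h | h
    · exact key t ht h
    · rcases lt_or_eq_of_le ht with h1 | rfl
      · exact ⟨t + 1, h1, Or.inl (by rw [h, alt_succ])⟩
      · exact key _ ht (h.trans (alt_label hk hij h0 ν).symm)
  induction h with
  | refl => exact hv
  | @tail a b _ hab ih =>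
    obtain ⟨t, ht, h⟩ := ih
    rcases hab with rfl | rfl
    · exact main i j hij h0 t ht _ h
    · obtain ⟨t', ht', h'⟩ := main j i hij.symm (by rwa [hk.symm]) t (by rwa [hk.symm]) _ h.symm
      exact ⟨t', by rwa [hk.symm], h'.symm⟩

theorem orb_to_alt (hk : IsLabelling k) {i j : I} (hij : i ≠ j)
    {ν : I → ℝ} {m : ℕ} (hν : Reach (wt k) m ν) (hi : 0 < ν i) (hj : 0 < ν j) :
    ∀ t ≤ k i j, ∀ u : Pos k, (u.1 = alt (wt k) t i j ν ∨ u.1 = alt (wt k) t j i ν) →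
      Orb (move hk) i j ⟨ν, m, hν⟩ u
  | 0, _, u, h => by
    have : u = ⟨ν, m, hν⟩ := Subtype.ext (by simpa using h)
    rw [this]; exact Relation.ReflTransGen.refl
  | t + 1, ht, u, h => by
    obtain ⟨r1, r2⟩ := reach_alt hk hij hν hi hj (t := t) (by omega)
    rcases h with h | h
    · exact (orb_to_alt hk hij hν hi hj t (by omega) ⟨_, _, r2⟩ (Or.inr rfl)).tail
        (Or.inl (Subtype.ext h))
    · exact (orb_to_alt hk hij hν hi hj t (by omega) ⟨_, _, r1⟩ (Or.inl rfl)).tail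
        (Or.inr (Subtype.ext h))

end Pos

theorem orb_symm {I V : Type*} {s : I → V → V} (hs : ∀ i v, s i (s i v) = v) {i j : I} {v u : V}
    (h : Orb s i j v u) : Orb s i j u v := by
  induction h with
  | refl => exact Relation.ReflTransGen.refl
  | @tail a b _ hab ih =>
    refine Relation.ReflTransGen.head ?_ ih
    rcases hab with rfl | rfl
    · exact Or.inl (hs _ _).symm
    · exact Or.inr (hs _ _).symm

theorem Pos.exists_form_of_neg (hk : IsLabelling k) {i j : I} {w : Pos k} (hij : i ≠ j) (hi
    : w.1 i < 0)
    (hj : w.1 j < 0) :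
    k i j ≠ 0 ∧ ∃ ν m, Reach (wt k) m ν ∧ 0 < ν i ∧ 0 < ν j ∧ w.rk = m + k i j ∧
      w.1 = alt (wt k) (k i j) i j ν := by
  have h0 : k i j ≠ 0 := fun h0 => by
    have := reach_pair_pos hk hij h0 w.reach
    linarith
  refine ⟨h0, ?_⟩
  obtain ⟨t, ν, m, ht, hn, hν, hνi, hνj, h⟩ := exists_alt hk hij h0 w.reach
  rcases lt_or_eq_of_le ht with h1 | rfl
  · exfalso
    rcases h with h | h
    · rw [h] at hj; exact absurd (alt_next_pos hk hij h1 hνi hνj) (not_lt.2 hj.le)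
    · rw [h] at hi
      exact absurd (alt_next_pos hk hij.symm (by rwa [hk.symm]) hνj hνi) (not_lt.2 hi.le)
  · exact ⟨ν, m, hν, hνi, hνj, hn, h.elim id fun h => h.trans (alt_label hk hij h0 ν).symm⟩

/-- The chamber game of reachable positions. -/
noncomputable def game (hk : IsLabelling k) : ChamberGame I where
  V := Pos k
  s := Pos.move hk
  rk := Pos.rk
  neg i v := v.1 i < 0
  k := k
  s_s i v := Subtype.ext (fire_fire _ i v.1)
  neg_s i v := by
    change fire (wt k) i v.1 i < 0 ↔ _
    have := (isGood hk _ _ v.reach i).1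
    rw [fire_same, neg_lt_zero, not_lt]
    exact ⟨le_of_lt, fun h => lt_of_le_of_ne h this.symm⟩
  rk_s i v h := by
    have := (isGood hk _ _ v.reach i).1
    exact Pos.rk_eq hk (v.reach.step (lt_of_le_of_ne (not_lt.1 h) this.symm))
  k_symm := hk.symm
  not_three i j l v hij hjl hil hi hj :=
    not_lt.2 (reach_not_three_neg hk hij hjl hil v.reach hi hj)
  k_ne_zero i j w hij hi hj := (Pos.exists_form_of_neg hk hij hi hj).1
  top i j w u hij hi hj h := by
    obtain ⟨h0, ν, m, hν, hνi, hνj, hr, hw⟩ := Pos.exists_form_of_neg hk hij hi hj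
    obtain ⟨t, ht, hu⟩ := Pos.orb_alt hk hij h0 hν hνi hνj ⟨_, le_rfl, Or.inl hw⟩ h
    rcases lt_or_eq_of_le ht with h1 | rfl
    · right
      obtain ⟨r1, r2⟩ := reach_alt hk hij hν hνi hνj ht
      rcases hu with hu | hu
      · refine ⟨fun h => absurd h.2 (not_lt.2 ?_), ?_⟩
        · rw [hu]; exact (alt_next_pos hk hij h1 hνi hνj).le
        · rw [hr, Pos.rk_eq hk (n := m + t) (by rwa [hu])]; omega
      · refine ⟨fun h => absurd h.1 (not_lt.2 ?_), ?_⟩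
        · rw [hu]; exact (alt_next_pos hk hij.symm (by rwa [hk.symm]) hνj hνi).le
        · rw [hr, Pos.rk_eq hk (n := m + t) (by rwa [hu])]; omega
    · left
      refine Subtype.ext ?_
      rw [hw]
      exact hu.elim id fun h => h.trans (alt_label hk hij h0 ν).symm
  bot i j w u hij hi hj h := by
    obtain ⟨h0, ν, m, hν, hνi, hνj, hr, hw⟩ := Pos.exists_form_of_neg hk hij hi hj
    obtain ⟨t, ht, hu⟩ := Pos.orb_alt hk hij h0 hν hνi hνj ⟨_, le_rfl, Or.inl hw⟩ h
    obtain ⟨r1, r2⟩ := reach_alt hk hij hν hνi hνj ht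
    have : u.rk = m + t := by
      rcases hu with hu | hu <;> exact Pos.rk_eq hk (by rwa [hu])
    omega
  exists_top i j v hij h0 := by
    obtain ⟨t, ν, m, ht, -, hν, hνi, hνj, h⟩ := exists_alt hk hij h0 v.reach
    refine ⟨⟨_, _, (reach_alt hk hij hν hνi hνj le_rfl).1⟩, ?_, ?_, ?_⟩
    · exact (orb_symm (fun i v => Subtype.ext (fire_fire _ i v.1))
        (Pos.orb_to_alt hk hij hν hνi hνj _ le_rfl _ (Or.inl rfl))).trans
        (Pos.orb_to_alt hk hij hν hνi hνj t ht v h)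
    · exact alt_last_neg hk hij hνi hνj (Nat.pos_of_ne_zero h0) le_rfl
    · change alt (wt k) (k i j) i j ν j < 0
      rw [alt_label hk hij h0]
      exact alt_last_neg hk hij.symm hνj hνi (Nat.pos_of_ne_zero h0) (by rw [hk.symm])

end NumbersGame

/-! ### Group actions built from panels -/

/-- An action of `Γ` on two copies of `Ω` that is free and in which nontrivial elements move
the lower copy into the upper one. -/
structure IsPanel {Γ Ω : Type*} [Group Γ] (φ : Γ →* Equiv.Perm (Ω ⊕ Ω)) : Prop where
  free : ∀ g z, φ g z = z → g = 1
  lower : ∀ g ω, g ≠ 1 → ∃ ω', φ g (Sum.inl ω) = Sum.inr ω'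

theorem exists_isPanel {Γ Ω : Type*} [Group Γ] (e : Ω ≃ {g : Γ // g ≠ 1} × Ω) :
    ∃ φ : Γ →* Equiv.Perm (Ω ⊕ Ω), IsPanel φ := by
  classical
  let f : Ω ⊕ Ω → Γ × Ω := Sum.elim (fun ω => (1, ω)) (fun ω => ((e ω).1, (e ω).2))
  let f' : Γ × Ω → Ω ⊕ Ω := fun p =>
    if h : p.1 = 1 then Sum.inl p.2 else Sum.inr (e.symm (⟨p.1, h⟩, p.2))
  have hf' : ∀ p, f (f' p) = p := by
    rintro ⟨g, ω⟩
    by_cases h : g = 1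
    · simp [f, f', h]
    · simp [f, f', h]
  have hf : ∀ z, f' (f z) = z := by
    rintro (ω | ω)
    · simp [f, f']
    · simp [f, f', (e ω).1.2]
  let φ : Γ →* Equiv.Perm (Ω ⊕ Ω) :=
    { toFun := fun g =>
        { toFun := fun z => f' (g * (f z).1, (f z).2)
          invFun := fun z => f' (g⁻¹ * (f z).1, (f z).2)
          left_inv := fun z => by simp [hf', hf]
          right_inv := fun z => by simp [hf', hf] }
      map_one' := by ext z; simp [hf]
      map_mul' := fun g h => by ext z; simp [hf', mul_assoc] }
  refine ⟨φ, fun g z h => ?_, fun g ω h => ?_⟩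
  · have := congrArg (fun z => (f z).1) h
    simpa [φ, hf'] using this
  · refine ⟨e.symm (⟨g, h⟩, ω), ?_⟩
    simp [f', φ, f, h]

/-- A group action restricts along an injection with invariant range. -/
theorem exists_restrict {Γ A Y : Type*} [Group Γ] (ψ : Γ →* Equiv.Perm Y) (F : A → Y)
    (hF : Function.Injective F) (hinv : ∀ (g : Γ) a, ∃ b, F b = ψ g (F a)) :
    ∃ φ : Γ →* Equiv.Perm A, ∀ g a, F (φ g a) = ψ g (F a) := by
  choose f hf using hinv
  refine ⟨{ toFun := fun g => ⟨f g, f g⁻¹, fun a => hF ?_, fun a => hF ?_⟩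
            map_one' := ?_
            map_mul' := fun g h => ?_ }, fun g a => hf g a⟩
  · simp [hf]
  · simp [hf]
  · ext a; exact hF (by simp [hf])
  · ext a; exact hF (by simp [hf])

/-- Orbit representatives that prefer the points satisfying `A`. -/
theorem exists_orbit_rep {Γ Z : Type*} [Group Γ] (φ : Γ →* Equiv.Perm Z) (A : Z → Prop)
    (hA : ∀ z g, A z → A (φ g z) → φ g z = z) :
    ∃ p : Z → Z, (∀ z, ∃ g, φ g (p z) = z) ∧ (∀ g z, p (φ g z) = p z) ∧ ∀ z, A z → p z = z := by
  classical
  let R : Setoid Z :=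
    { r := fun a b => ∃ g, φ g a = b
      iseqv :=
        { refl := fun a => ⟨1, by simp⟩
          symm := by rintro a b ⟨g, rfl⟩; exact ⟨g⁻¹, by simp⟩
          trans := by rintro a b c ⟨g, rfl⟩ ⟨h, rfl⟩; exact ⟨h * g, by simp⟩ } }
  have hR : ∀ a b, R a b ↔ ∃ g, φ g a = b := fun _ _ => Iff.rfl
  let q : Quotient R → Z := fun c => if h : ∃ z, A z ∧ Quotient.mk R z = c then h.choose else c.out
  have hq : ∀ c, Quotient.mk R (q c) = c := by
    intro c
    by_cases h : ∃ z, A z ∧ Quotient.mk R z = c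
    · simp only [q, dif_pos h]; exact h.choose_spec.2
    · simp only [q, dif_neg h]; exact Quotient.out_eq c
  refine ⟨fun z => q (Quotient.mk R z), fun z => (hR _ _).1 (Quotient.exact (hq _)), fun g z => ?_,
    fun z hz => ?_⟩
  · exact congrArg q (Quotient.sound ((hR _ _).2 ⟨g⁻¹, by simp⟩))
  · have h : ∃ z', A z' ∧ Quotient.mk R z' = Quotient.mk R z := ⟨z, hz, rfl⟩
    have e : q (Quotient.mk R z) = h.choose := dif_pos h
    obtain ⟨g, hg⟩ := (hR _ _).1 (Quotient.exact h.choose_spec.2.symm)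
    change q (Quotient.mk R z) = z
    rw [e, ← hg]
    exact hA z g hz (by rw [hg]; exact h.choose_spec.1)

/-- Recursive construction of a function whose value at `w` is constrained only by the values at
elements of smaller rank. -/
theorem exists_of_local {V : Type*} {X : V → Type*} [DecidableEq V] (rk : V → ℕ)
    (Q : V → (∀ v, X v) → Prop) (f₀ : ∀ v, X v)
    (hloc : ∀ w f f', (∀ u, rk u < rk w ∨ u = w → f u = f' u) → Q w f → Q w f')
    (hstep : ∀ w f, ∃ x, Q w (Function.update f w x)) : ∃ f, ∀ w, Q w f := by
  classical
  have wf : WellFounded fun a b : V => rk a < rk b := (measure rk).wf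
  choose x hx using hstep
  let f : ∀ v, X v := wf.fix fun w rec => x w fun u => if h : rk u < rk w then rec u h else f₀ u
  have hf : ∀ w, f w = x w fun u => if rk u < rk w then f u else f₀ u := by
    intro w
    change wf.fix _ w = _
    rw [wf.fix_eq]
    rfl
  refine ⟨f, fun w => hloc w _ _ ?_ (hx w fun u => if rk u < rk w then f u else f₀ u)⟩
  rintro u (h | rfl)
  · have : u ≠ w := by rintro rfl; exact lt_irrefl _ h
    rw [Function.update_of_ne this, if_pos h]
  · rw [Function.update_self, ← hf]

namespace ChamberGame

variable {I : Type*} (D : ChamberGame I) (G : I → Type*) [∀ i, Group (G i)] (Ω : Type*)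

/-- A choice of panels at one state, for all types. -/
abbrev Panels : Type _ := ∀ i, {φ : G i →* Equiv.Perm (Ω ⊕ Ω) // IsPanel φ}

variable {G Ω}

open Classical in
/-- The panel of type `i` containing a chamber, and its position in that panel. -/
noncomputable def enc (i : I) (z : D.V × Ω) : D.V × (Ω ⊕ Ω) :=
  if D.neg i z.1 then (z.1, Sum.inr z.2) else (D.s i z.1, Sum.inl z.2)

/-- The chamber at a given position of the panel of type `i` below `w`. -/
def dec (i : I) (w : D.V) : Ω ⊕ Ω → D.V × Ω
  | Sum.inl ω => (D.s i w, ω)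
  | Sum.inr ω => (w, ω)

theorem enc_neg (i : I) (z : D.V × Ω) : D.neg i (D.enc i z).1 := by
  by_cases h : D.neg i z.1
  · simp [enc, h]
  · simp [enc, h, D.neg_s]

theorem dec_enc (i : I) (z : D.V × Ω) : D.dec i (D.enc i z).1 (D.enc i z).2 = z := by
  by_cases h : D.neg i z.1
  · simp [enc, h, dec]
  · simp [enc, h, dec, D.s_s]

theorem enc_dec (i : I) {w : D.V} (h : D.neg i w) (a : Ω ⊕ Ω) :
    D.enc i (D.dec i w a) = (w, a) := by
  rcases a with ω | ω
  · have : ¬ D.neg i (D.s i w) := by rwa [D.neg_s, not_not]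
    simp [enc, dec, this, D.s_s]
  · simp [enc, dec, h]

theorem dec_injective (i : I) {w : D.V} (h : D.neg i w) :
    Function.Injective (D.dec (Ω := Ω) i w) := fun a b hab => by
  have := congrArg (D.enc i) hab
  rw [enc_dec D i h, enc_dec D i h] at this
  exact (Prod.ext_iff.1 this).2

theorem enc_fst (i : I) (z : D.V × Ω) : (D.enc i z).1 = z.1 ∨ (D.enc i z).1 = D.s i z.1 := by
  by_cases h : D.neg i z.1
  · simp [enc, h]
  · simp [enc, h]

theorem dec_fst (i : I) (w : D.V) (a : Ω ⊕ Ω) :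
    (D.dec i w a).1 = w ∨ (D.dec i w a).1 = D.s i w := by
  rcases a with ω | ω <;> simp [dec]

/-- The action of the vertex group `G i` on chambers. -/
noncomputable def act (ρ : D.V → Panels G Ω) (i : I) : G i →* Equiv.Perm (D.V × Ω) where
  toFun g :=
    { toFun := fun z => D.dec i (D.enc i z).1 ((ρ (D.enc i z).1 i).1 g (D.enc i z).2)
      invFun := fun z => D.dec i (D.enc i z).1 ((ρ (D.enc i z).1 i).1 g⁻¹ (D.enc i z).2)
      left_inv := fun z => by simp [enc_dec D i (D.enc_neg i z), dec_enc]
      right_inv := fun z => by simp [enc_dec D i (D.enc_neg i z), dec_enc] }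
  map_one' := by ext1 z; simp [dec_enc]
  map_mul' g h := by ext1 z; simp [enc_dec D i (D.enc_neg i z)]

theorem act_apply (ρ : D.V → Panels G Ω) (i : I) (g : G i) (z : D.V × Ω) :
    D.act ρ i g z = D.dec i (D.enc i z).1 ((ρ (D.enc i z).1 i).1 g (D.enc i z).2) := rfl

theorem enc_act (ρ : D.V → Panels G Ω) (i : I) (g : G i) (z : D.V × Ω) :
    D.enc i (D.act ρ i g z) = ((D.enc i z).1, (ρ (D.enc i z).1 i).1 g (D.enc i z).2) := by
  rw [act_apply, enc_dec D i (D.enc_neg i z)]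

theorem act_free (ρ : D.V → Panels G Ω) {i : I} {g : G i} {z : D.V × Ω}
    (h : D.act ρ i g z = z) : g = 1 := by
  have := D.enc_act ρ i g z
  rw [h] at this
  exact (ρ (D.enc i z).1 i).2.free g _ (Prod.ext_iff.1 this).2.symm

theorem act_fst (ρ : D.V → Panels G Ω) {i : I} {g : G i} (hg : g ≠ 1) {z : D.V × Ω}
    (hz : ¬ D.neg i z.1) : (D.act ρ i g z).1 = D.s i z.1 := by
  have e : D.enc i z = (D.s i z.1, Sum.inl z.2) := by simp [enc, hz]
  rw [act_apply, e]
  obtain ⟨ω', h⟩ := (ρ (D.s i z.1) i).2.lower g z.2 hg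
  simp only [h]
  rfl

theorem act_fst_cases (ρ : D.V → Panels G Ω) (i : I) (g : G i) (z : D.V × Ω) :
    (D.act ρ i g z).1 = z.1 ∨ (D.act ρ i g z).1 = D.s i z.1 := by
  rw [act_apply]
  rcases D.enc_fst i z with h | h <;>
  rcases D.dec_fst i (D.enc i z).1 ((ρ (D.enc i z).1 i).1 g (D.enc i z).2) with h' | h' <;>
  rw [h', h] <;> simp [D.s_s]

theorem act_congr {ρ ρ' : D.V → Panels G Ω} {i : I} {g : G i} {z : D.V × Ω}
    (h : ρ (D.enc i z).1 i = ρ' (D.enc i z).1 i) : D.act ρ i g z = D.act ρ' i g z := by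
  rw [act_apply, act_apply, h]

/-- The action of the free product of the vertex groups on chambers. -/
noncomputable def toPerm (ρ : D.V → Panels G Ω) : CoprodI G →* Equiv.Perm (D.V × Ω) :=
  CoprodI.lift (D.act ρ)

@[simp] theorem toPerm_of (ρ : D.V → Panels G Ω) (i : I) (g : G i) :
    D.toPerm ρ (CoprodI.of g) = D.act ρ i g := CoprodI.lift_of _ _

end ChamberGame

namespace ChamberGame

variable {I : Type*} (D : ChamberGame I) {G : I → Type*} [∀ i, Group (G i)] {Ω : Type*}

/-- The product in the free product of a list of letters. -/
def letterProd {I : Type*} {G : I → Type*} [∀ i, Group (G i)] (l : List (Σ t, G t)) :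
    CoprodI G := (l.map fun x => CoprodI.of x.2).prod

@[simp] theorem letterProd_nil {I : Type*} {G : I → Type*} [∀ i, Group (G i)] :
    letterProd ([] : List (Σ t, G t)) = 1 := rfl

@[simp] theorem letterProd_cons {I : Type*} {G : I → Type*} [∀ i, Group (G i)] (x : Σ t, G t)
    (l : List (Σ t, G t)) : letterProd (x :: l) = CoprodI.of x.2 * letterProd l := by
  simp [letterProd]

@[simp] theorem letterProd_append {I : Type*} {G : I → Type*} [∀ i, Group (G i)]
    (l l' : List (Σ t, G t)) : letterProd (l ++ l') = letterProd l * letterProd l' := by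
  simp [letterProd]

theorem act_eq_of_not_neg (ρ : D.V → Panels G Ω) (t : I) (z : D.V × Ω) (g : G t)
    (h : ¬ D.neg t z.1) (h' : ¬ D.neg t (D.act ρ t g z).1) : D.act ρ t g z = z := by
  by_cases hg : g = 1
  · simp [hg]
  · rw [D.act_fst ρ hg h, D.neg_s] at h'
    exact absurd h' (not_not.2 h)

theorem exists_rec {Z X : Type*} [Inhabited X] (rk : Z → ℕ) (F : Z → (Z → X) → X) :
    ∃ f : Z → X, ∀ z, f z = F z fun u => if rk u < rk z then f u else default := by
  classical
  have wf : WellFounded fun a b : Z => rk a < rk b := (measure rk).wf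
  refine ⟨wf.fix fun z rec => F z fun u => if h : rk u < rk z then rec u h else default,
    fun z => ?_⟩
  conv_lhs => rw [wf.fix_eq]
  rfl

/-- Normal forms of chambers under the two vertex groups `G i` and `G j`. -/
theorem exists_norm (ρ : D.V → Panels G Ω) (i j : I) :
    ∃ (r : D.V × Ω → D.V × Ω) (γ : D.V × Ω → CoprodI G),
      (∀ z, D.toPerm ρ (γ z) (r z) = z) ∧
      (∀ t (g : G t) z, (t = i ∨ t = j) → ¬ (D.neg i z.1 ∧ D.neg j z.1) →
        ¬ (D.neg i (D.act ρ t g z).1 ∧ D.neg j (D.act ρ t g z).1) →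
        r (D.act ρ t g z) = r z ∧ γ (D.act ρ t g z) = CoprodI.of g * γ z) ∧
      ∀ z, ∃ l : List (Σ t, G t), letterProd l = γ z ∧ (∀ x ∈ l, x.1 = i ∨ x.1 = j) ∧
        ∀ m, (∀ u, Orb D.s i j z.1 u → m ≤ D.rk u + D.k i j) →
          m + l.length ≤ D.rk z.1 + D.k i j := by
  classical
  have hp := fun t => exists_orbit_rep (D.act ρ t) (fun z => ¬ D.neg t z.1)
    (fun z g h h' => D.act_eq_of_not_neg ρ t z g h h')
  choose p hp₁ hp₂ hp₃ using hp
  choose σ hσ using hp₁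
  have hσ₁ : ∀ t (g : G t) z, σ t (D.act ρ t g z) = g * σ t z := by
    intro t g z
    have e : D.act ρ t (g * σ t z) (p t z) = D.act ρ t (σ t (D.act ρ t g z)) (p t z) := by
      rw [map_mul, Equiv.Perm.mul_apply, hσ, ← hp₂ t g z, hσ]
    have : D.act ρ t ((g * σ t z)⁻¹ * σ t (D.act ρ t g z)) (p t z) = p t z := by
      rw [map_mul, Equiv.Perm.mul_apply, ← e, ← Equiv.Perm.mul_apply, ← map_mul]; simp
    exact (inv_mul_eq_one.1 (D.act_free ρ this)).symm
  have hσ₃ : ∀ t z, ¬ D.neg t z.1 → σ t z = 1 := by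
    intro t z h
    have := hσ t z
    rw [hp₃ t z h] at this
    exact D.act_free ρ this
  let dn : I → D.V × Ω → (D.V × Ω → (D.V × Ω) × CoprodI G) → (D.V × Ω) × CoprodI G :=
    fun t z f => if D.neg t (p t z).1 then (p t z, CoprodI.of (σ t z))
      else ((f (p t z)).1, CoprodI.of (σ t z) * (f (p t z)).2)
  rcases isEmpty_or_nonempty (D.V × Ω) with hZ | ⟨⟨z₀⟩⟩
  · exact ⟨id, fun _ => 1, fun z => hZ.elim z, fun _ _ z => hZ.elim z, fun z => hZ.elim z⟩
  have : Inhabited ((D.V × Ω) × CoprodI G) := ⟨(z₀, 1)⟩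
  obtain ⟨f, hf⟩ := exists_rec (fun z : D.V × Ω => D.rk z.1)
    fun z f => if D.neg i z.1 ∧ ¬ D.neg j z.1 then dn i z f
      else if D.neg j z.1 ∧ ¬ D.neg i z.1 then dn j z f else (z, 1)
  have hrk : ∀ t z, D.neg t z.1 → ¬ D.neg t (p t z).1 →
      D.rk z.1 = D.rk (p t z).1 + 1 ∧ (p t z).1 = D.s t z.1 := by
    intro t z h h'
    have h1 : σ t z ≠ 1 := fun h1 => by
      have := hσ t z
      rw [h1, map_one] at this
      simp only [Equiv.Perm.one_apply] at this
      rw [this] at h'; exact h' h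
    have h2 := D.act_fst ρ h1 h'
    rw [hσ] at h2
    exact ⟨by rw [h2, D.rk_s _ _ h'], by rw [h2, D.s_s]⟩
  have hdn : ∀ t z, D.neg t z.1 →
      dn t z (fun u => if D.rk u.1 < D.rk z.1 then f u else default) = dn t z f := by
    intro t z h
    by_cases h' : D.neg t (p t z).1
    · simp [dn, h']
    · have := (hrk t z h h').1
      simp [dn, h', this]
  have hlone : ∀ t z, (t = i ∨ t = j) → ¬ (D.neg i z.1 ∧ D.neg j z.1) → D.neg t z.1 →
      f z = dn t z f := by
    rintro t z (rfl | rfl) hB h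
    · rw [hf, if_pos ⟨h, fun h' => hB ⟨h, h'⟩⟩, hdn _ _ h]
    · rw [hf, if_neg (fun h' => h'.2 h), if_pos ⟨h, fun h' => hB ⟨h', h⟩⟩, hdn _ _ h]
  have hstay : ∀ z, (¬ ∃ t, (t = i ∨ t = j) ∧ ¬ (D.neg i z.1 ∧ D.neg j z.1) ∧ D.neg t z.1) →
      f z = (z, 1) := by
    intro z h
    rw [hf, if_neg (fun h' => h ⟨i, Or.inl rfl, fun h2 => h'.2 h2.2, h'.1⟩),
      if_neg (fun h' => h ⟨j, Or.inr rfl, fun h2 => h'.2 h2.1, h'.1⟩)]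
  have hup : ∀ t (g : G t) z, (t = i ∨ t = j) →
      ¬ (D.neg i (D.act ρ t g z).1 ∧ D.neg j (D.act ρ t g z).1) → ¬ D.neg t z.1 → g ≠ 1 →
      f (D.act ρ t g z) = ((f z).1, CoprodI.of g * (f z).2) := by
    intro t g z ht hB hz hg
    have hn : D.neg t (D.act ρ t g z).1 := by rw [D.act_fst ρ hg hz, D.neg_s]; exact hz
    rw [hlone t _ ht hB hn]
    simp only [dn, hp₂, hp₃ t z hz, if_neg hz, hσ₁, hσ₃ t z hz, mul_one]
  refine ⟨fun z => (f z).1, fun z => (f z).2, fun z => ?_, fun t g z ht hz hz' => ?_,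
    fun z => ?_⟩ <;> dsimp only
  · induction h : D.rk z.1 using Nat.strong_induction_on generalizing z with
    | _ n ih =>
      subst h
      by_cases h : ∃ t, (t = i ∨ t = j) ∧ ¬ (D.neg i z.1 ∧ D.neg j z.1) ∧ D.neg t z.1
      · obtain ⟨t, ht, hB, hn⟩ := h
        rw [hlone t z ht hB hn]
        by_cases h' : D.neg t (p t z).1
        · simp [dn, h', hσ]
        · simp [dn, h', ih _ (by rw [(hrk t z hn h').1]; omega) (p t z) rfl, hσ]
      · simp [hstay z h]
  · by_cases hg : g = 1
    · subst hg; simp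
    by_cases h : D.neg t z.1
    · by_cases h' : D.neg t (D.act ρ t g z).1
      · rw [hlone t _ ht hz' h', hlone t z ht hz h]
        by_cases h2 : D.neg t (p t z).1
        · simp [dn, hp₂, h2, hσ₁]
        · simp [dn, hp₂, h2, hσ₁, mul_assoc]
      · have e : D.act ρ t g⁻¹ (D.act ρ t g z) = z := by simp
        have := hup t g⁻¹ (D.act ρ t g z) ht (by rwa [e]) h' (by simpa using hg)
        rw [e] at this
        simp [this]
    · simp [hup t g z ht hz' h hg]
  · induction h : D.rk z.1 using Nat.strong_induction_on generalizing z with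
    | _ n ih =>
      subst h
      by_cases h : ∃ t, (t = i ∨ t = j) ∧ ¬ (D.neg i z.1 ∧ D.neg j z.1) ∧ D.neg t z.1
      · obtain ⟨t, ht, hB, hn⟩ := h
        rw [hlone t z ht hB hn]
        have hs : Orb D.s i j z.1 (D.s t z.1) := by
          rcases ht with rfl | rfl
          · exact .single (Or.inl rfl)
          · exact .single (Or.inr rfl)
        have hsr : D.rk z.1 = D.rk (D.s t z.1) + 1 := by
          have := D.rk_s t (D.s t z.1) (by rw [D.neg_s, not_not]; exact hn)
          rwa [D.s_s] at this
        by_cases h' : D.neg t (p t z).1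
        · refine ⟨[⟨t, σ t z⟩], by simp [dn, h'], by simpa using ht, fun m hm => ?_⟩
          have := hm _ hs
          simp only [List.length_singleton]
          omega
        · obtain ⟨h1, h2⟩ := hrk t z hn h'
          obtain ⟨l, hl₁, hl₂, hl₃⟩ := ih _ (by rw [h1]; omega) (p t z) rfl
          refine ⟨⟨t, σ t z⟩ :: l, by simp [dn, h', hl₁], ?_, fun m hm => ?_⟩
          · rintro x (_ | ⟨_, hx⟩)
            exacts [ht, hl₂ x hx]
          · have := hl₃ m fun u hu => hm u (hs.trans (by rwa [h2] at hu))
            simp only [List.length_cons]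
            omega
      · refine ⟨[], by simp [hstay z h], by simp, fun m hm => ?_⟩
        simpa using hm z.1 .refl

end ChamberGame

namespace ChamberGame

variable {I : Type*} (D : ChamberGame I) {G : I → Type*} [∀ i, Group (G i)] {Ω : Type*}

/-- The action on `B × Γ ⧸ N` by left translation of the second factor. -/
def translate {Γ : Type*} [Group Γ] (N : Subgroup Γ) [N.Normal] (B : Type*) :
    Γ →* Equiv.Perm (B × (Γ ⧸ N)) where
  toFun c := Equiv.prodCongr (Equiv.refl B) (Equiv.mulLeft (c : Γ ⧸ N))
  map_one' := by ext1 y; simp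
  map_mul' c d := by ext1 ⟨y, h⟩; simp [mul_assoc]

theorem translate_apply {Γ : Type*} [Group Γ] (N : Subgroup Γ) [N.Normal] (B : Type*) (c : Γ)
    (y : B × (Γ ⧸ N)) : translate N B c y = (y.1, (c : Γ ⧸ N) * y.2) := rfl

theorem eq_of_letterProd_mk_eq (N : Subgroup (CoprodI G)) {i j : I} {n : ℕ}
    (hgirth : ∀ l : List (Σ t, G t), (∀ x ∈ l, x.1 = i ∨ x.1 = j) → l.length < n →
      letterProd l ∈ N → letterProd l = 1)
    {l l' : List (Σ t, G t)} (hl : ∀ x ∈ l, x.1 = i ∨ x.1 = j)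
    (hl' : ∀ x ∈ l', x.1 = i ∨ x.1 = j) (hn : l.length + l'.length < n)
    (h : (letterProd l : CoprodI G ⧸ N) = letterProd l') : letterProd l = letterProd l' := by
  let iv : List (Σ t, G t) := (l.map fun x => ⟨x.1, x.2⁻¹⟩).reverse
  have hiv : letterProd iv = (letterProd l)⁻¹ := by
    simp only [letterProd, iv, List.prod_inv_reverse, List.map_reverse, List.map_map]
    simp [Function.comp_def]
  have := hgirth (iv ++ l') (by
    intro x hx
    rcases List.mem_append.1 hx with hx | hx
    · simp only [iv, List.mem_reverse, List.mem_map] at hx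
      obtain ⟨y, hy, rfl⟩ := hx
      exact hl y hy
    · exact hl' x hx) (by simpa [iv] using hn)
    (by rw [letterProd_append, hiv]; exact QuotientGroup.eq.1 h)
  rw [letterProd_append, hiv] at this
  exact inv_mul_eq_one.1 this

theorem exists_panels (ρ : D.V → Panels G Ω) {i j : I} (hij : i ≠ j) {w : D.V}
    (hi : D.neg i w) (hj : D.neg j w) (N : Subgroup (CoprodI G)) [N.Normal]
    (hk : 2 ≤ D.k i j)
    (hgirth : ∀ l : List (Σ t, G t), (∀ x ∈ l, x.1 = i ∨ x.1 = j) → l.length < 2 * D.k i j →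
      letterProd l ∈ N → letterProd l = 1)
    (κ : ((D.V × Ω) ⊕ Ω) × (CoprodI G ⧸ N) ↪ Ω) :
    ∃ x : Panels G Ω, ∀ ρ' : D.V → Panels G Ω, ρ' w = x → (∀ u, u ≠ w → ρ' u = ρ u) →
      ∀ l : List (Σ t, G t), (∀ x ∈ l, x.1 = i ∨ x.1 = j) →
        letterProd l ∈ N → ∀ z, Orb D.s i j w z.1 → D.toPerm ρ' (letterProd l) z = z := by
  classical
  obtain ⟨r, γ, h₁, h₂, h₃⟩ := D.exists_norm ρ i j
  let L := translate N ((D.V × Ω) ⊕ Ω)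
  let ι : D.V × Ω → ((D.V × Ω) ⊕ Ω) × (CoprodI G ⧸ N) := fun z => (Sum.inl (r z), γ z)
  let S : D.V × Ω → Prop := fun z => Orb D.s i j w z.1 ∧ z.1 ≠ w
  have hB : ∀ z, S z → ¬ (D.neg i z.1 ∧ D.neg j z.1) := fun z hz =>
    ((D.top i j w z.1 hij hi hj hz.1).resolve_left hz.2).1
  have hrkS : ∀ z, S z → D.rk z.1 < D.rk w := fun z hz =>
    ((D.top i j w z.1 hij hi hj hz.1).resolve_left hz.2).2
  have hlen : ∀ z, S z → ∃ l : List (Σ t, G t), letterProd l = γ z ∧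
      (∀ x ∈ l, x.1 = i ∨ x.1 = j) ∧ l.length < D.k i j := by
    intro z hz
    obtain ⟨l, a, b, c⟩ := h₃ z
    have := c (D.rk w) fun u hu => D.bot i j w u hij hi hj (hz.1.trans hu)
    exact ⟨l, a, b, by have := hrkS z hz; omega⟩
  have hιS : ∀ z z', S z → S z' → ι z = ι z' → z = z' := by
    intro z z' hz hz' h
    obtain ⟨l, a, b, c⟩ := hlen z hz
    obtain ⟨l', a', b', c'⟩ := hlen z' hz'
    simp only [ι, Prod.mk.injEq, Sum.inl.injEq] at h
    have := eq_of_letterProd_mk_eq N hgirth b b' (by omega) (by rw [a, a']; exact h.2)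
    rw [← h₁ z, ← h₁ z', h.1, ← a, ← a', this]
  have hιact : ∀ t (g : G t) z, (t = i ∨ t = j) → S z → S (D.act ρ t g z) →
      ι (D.act ρ t g z) = L (CoprodI.of g) (ι z) := by
    intro t g z ht hz hz'
    obtain ⟨a, b⟩ := h₂ t g z ht (hB _ hz) (hB _ hz')
    simp [ι, L, translate_apply, a, b]
  have hneg : ∀ {t}, t = i ∨ t = j → D.neg t w := by rintro t (rfl | rfl) <;> assumption
  have horb : ∀ {t}, t = i ∨ t = j → ∀ {u v}, Orb D.s i j u v → Orb D.s i j u (D.s t v) := by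
    rintro t (rfl | rfl) u v h
    · exact h.tail (Or.inl rfl)
    · exact h.tail (Or.inr rfl)
  have hsne : ∀ {t}, t = i ∨ t = j → D.s t w ≠ w := by
    intro t ht h
    have := D.neg_s t w
    rw [h] at this
    exact (iff_not_self this)
  have hSs : ∀ {t}, t = i ∨ t = j → ∀ ω, S (D.s t w, ω) := fun ht ω =>
    ⟨horb ht .refl, hsne ht⟩
  have hleave : ∀ t (g : G t) ω z', (t = i ∨ t = j) → g ≠ 1 → S z' →
      L (CoprodI.of g) (ι (D.s t w, ω)) ≠ ι z' := by
    intro t g ω z' ht hg hz' h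
    obtain ⟨l, a, b, c⟩ := hlen _ (hSs ht ω)
    obtain ⟨l', a', b', c'⟩ := hlen z' hz'
    simp only [ι, L, translate_apply, Prod.mk.injEq, Sum.inl.injEq] at h
    have := eq_of_letterProd_mk_eq N hgirth (l := ⟨t, g⟩ :: l)
      (by rintro x (_ | ⟨_, hx⟩); exacts [ht, b x hx]) b'
      (by simp only [List.length_cons]; omega) (by simpa [a, a'] using h.2)
    have e : D.act ρ t g (D.s t w, ω) = z' := by
      conv_lhs => rw [← h₁ (D.s t w, ω)]
      rw [← h₁ z', ← h.1, ← a, ← a', ← this]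
      simp
    have hn : ¬ D.neg t (D.s t w, ω).1 := by
      change ¬ D.neg t (D.s t w)
      rw [D.neg_s, not_not]; exact hneg ht
    have := D.act_fst ρ hg hn
    rw [e] at this
    exact hz'.2 (by rw [this]; exact D.s_s t w)
  let C := {y : ((D.V × Ω) ⊕ Ω) × (CoprodI G ⧸ N) // ∀ z, S z → ι z ≠ y}
  obtain ⟨e⟩ : Nonempty (Ω ≃ C) := by
    refine Function.Embedding.antisymm ⟨fun ω => ⟨(Sum.inr ω, 1), fun z _ => by simp [ι]⟩, ?_⟩
      ((Function.Embedding.subtype _).trans κ)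
    intro ω ω' h
    simpa using congrArg (fun y : C => y.1.1) h
  let Φ : D.V × Ω → ((D.V × Ω) ⊕ Ω) × (CoprodI G ⧸ N) := fun z =>
    if z.1 = w then (e z.2).1 else ι z
  have hΦw : ∀ ω, Φ (w, ω) = (e ω).1 := fun ω => if_pos rfl
  have hΦ : ∀ z, S z → Φ z = ι z := fun z hz => if_neg hz.2
  have hΦinj : ∀ z z', Orb D.s i j w z.1 → Orb D.s i j w z'.1 → Φ z = Φ z' → z = z' := by
    rintro ⟨u, ω⟩ ⟨u', ω'⟩ hz hz' h
    by_cases hu : u = w <;> by_cases hu' : u' = w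
    · subst hu; subst hu'
      rw [hΦw, hΦw] at h
      rw [e.injective (Subtype.ext h)]
    · subst hu
      rw [hΦw, hΦ _ ⟨hz', hu'⟩] at h
      exact absurd h.symm ((e ω).2 _ ⟨hz', hu'⟩)
    · subst hu'
      rw [hΦw, hΦ _ ⟨hz, hu⟩] at h
      exact absurd h ((e ω').2 _ ⟨hz, hu⟩)
    · rw [hΦ _ ⟨hz, hu⟩, hΦ _ ⟨hz', hu'⟩] at h
      exact hιS _ _ ⟨hz, hu⟩ ⟨hz', hu'⟩ h
  have hdecO : ∀ {t}, t = i ∨ t = j → ∀ a : Ω ⊕ Ω, Orb D.s i j w (D.dec t w a).1 := by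
    intro t ht a
    rcases a with ω | ω
    · exact horb ht .refl
    · exact .refl
  have hpanel : ∀ t, t = i ∨ t = j → ∃ φ : G t →* Equiv.Perm (Ω ⊕ Ω), IsPanel φ ∧
      ∀ g a, Φ (D.dec t w (φ g a)) = L (CoprodI.of g) (Φ (D.dec t w a)) := by
    intro t ht
    have hinj : Function.Injective fun a : Ω ⊕ Ω => Φ (D.dec t w a) := fun a b h =>
      D.dec_injective t (hneg ht) (hΦinj _ _ (hdecO ht a) (hdecO ht b) h)
    obtain ⟨φ, hφ⟩ := exists_restrict (L.comp CoprodI.of)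
      (fun a : Ω ⊕ Ω => Φ (D.dec t w a)) hinj (by
      intro g a
      by_cases hc : ∀ z, S z → ι z ≠ L (CoprodI.of g) (Φ (D.dec t w a))
      · refine ⟨Sum.inr (e.symm ⟨_, hc⟩), ?_⟩
        change Φ (w, _) = _
        rw [hΦw, Equiv.apply_symm_apply]; rfl
      push Not at hc
      obtain ⟨z, hz, hzι⟩ := hc
      by_cases hzs : z.1 = D.s t w
      · refine ⟨Sum.inl z.2, ?_⟩
        change Φ (D.s t w, _) = _
        rw [← hzs, hΦ _ hz]
        exact hzι
      exfalso
      set z' := D.act ρ t g⁻¹ z with hz'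
      have hz'1 := D.act_fst_cases ρ t g⁻¹ z
      rw [← hz'] at hz'1
      have hz'S : S z' := by
        rcases hz'1 with h | h
        · exact ⟨by rw [h]; exact hz.1, by rw [h]; exact hz.2⟩
        · refine ⟨by rw [h]; exact horb ht hz.1, fun h' => hzs ?_⟩
          rw [← h', h, D.s_s]
      have hz'Φ : Φ z' = Φ (D.dec t w a) := by
        rw [hΦ _ hz'S, hιact t g⁻¹ z ht hz hz'S, hzι, map_inv, map_inv]
        simp
      have hz'a := hΦinj _ _ hz'S.1 (hdecO ht a) hz'Φ
      have h1 : z'.1 = D.s t w := by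
        rw [hz'a]
        exact (D.dec_fst t w a).resolve_left (by rw [← hz'a]; exact hz'S.2)
      rcases hz'1 with h | h
      · exact hzs (by rw [← h, h1])
      · rw [h1] at h
        have := congrArg (D.s t) h
        rw [D.s_s, D.s_s] at this
        exact hz.2 this.symm)
    refine ⟨φ, ⟨fun g a h => ?_, fun g ω hg => ?_⟩, hφ⟩
    · have := hφ g a
      rw [h] at this
      have h2 := congrArg Prod.snd this
      simp only [MonoidHom.comp_apply, L, translate_apply] at h2
      have h3 : (CoprodI.of g : CoprodI G) ∈ N := by
        rw [← QuotientGroup.eq_one_iff]; exact mul_eq_right.1 h2.symm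
      have h4 := hgirth [⟨t, g⟩] (by simpa using ht) (by simp; omega) (by simpa using h3)
      exact CoprodI.of_injective t (by simpa using h4)
    · rcases hh : φ g (Sum.inl ω) with ω' | ω'
      · exfalso
        have := hφ g (Sum.inl ω)
        simp only [hh, dec, MonoidHom.comp_apply, hΦ _ (hSs ht _)] at this
        exact hleave t g ω _ ht hg (hSs ht ω') this.symm
      · exact ⟨ω', rfl⟩
  choose! φ hφp hφ using hpanel
  refine ⟨fun t => if ht : t = i ∨ t = j then ⟨φ t, hφp t ht⟩ else ρ w t, fun ρ' hw hu => ?_⟩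
  have hstep : ∀ t (g : G t) z, (t = i ∨ t = j) → Orb D.s i j w z.1 →
      Orb D.s i j w (D.act ρ' t g z).1 ∧
        Φ (D.act ρ' t g z) = L (CoprodI.of g) (Φ z) := by
    intro t g z ht hz
    have hO : Orb D.s i j w (D.act ρ' t g z).1 := by
      rcases D.act_fst_cases ρ' t g z with h | h
      · rw [h]; exact hz
      · rw [h]; exact horb ht hz
    refine ⟨hO, ?_⟩
    by_cases hc : (D.enc t z).1 = w
    · rw [act_apply, hc, hw]
      simp only [dif_pos ht]
      rw [hφ t ht]
      have hd := D.dec_enc t z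
      rw [hc] at hd
      rw [hd]
    · have e : D.act ρ' t g z = D.act ρ t g z := D.act_congr (congrFun (hu _ hc) t)
      have hnw : ∀ z' : D.V × Ω, (D.enc t z').1 ≠ w → z'.1 ≠ w := by
        intro z' h h'
        apply h
        have : D.neg t z'.1 := by rw [h']; exact hneg ht
        rw [enc, if_pos this]
        exact h'
      have hzS : S z := ⟨hz, hnw _ hc⟩
      rw [e] at hO ⊢
      have hzS' : S (D.act ρ t g z) := ⟨hO, hnw _ (by rw [D.enc_act]; exact hc)⟩
      rw [hΦ _ hzS, hΦ _ hzS', hιact t g z ht hzS hzS']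
  have hword : ∀ l : List (Σ t, G t), (∀ x ∈ l, x.1 = i ∨ x.1 = j) → ∀ z,
      Orb D.s i j w z.1 → Orb D.s i j w (D.toPerm ρ' (letterProd l) z).1 ∧
        Φ (D.toPerm ρ' (letterProd l) z) = L (letterProd l) (Φ z) := by
    intro l
    induction l with
    | nil => intro _ z hz; simpa using hz
    | cons x l ih =>
      intro hl z hz
      obtain ⟨a, b⟩ := ih (fun y hy => hl y (List.mem_cons_of_mem _ hy)) z hz
      have := hstep x.1 x.2 _ (hl x List.mem_cons_self) a
      simpa [b] using this
  intro l hl hlN z hz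
  obtain ⟨a, b⟩ := hword l hl z hz
  refine hΦinj _ _ a hz (b.trans ?_)
  simp [L, translate_apply, (QuotientGroup.eq_one_iff _).2 hlN]

end ChamberGame

namespace ChamberGame

variable {I : Type*} (D : ChamberGame I) {G : I → Type*} [∀ i, Group (G i)] {Ω : Type*}

/-- The state reached from `v` by performing the moves of a list, last entry first. -/
def run (v : D.V) : List I → D.V
  | [] => v
  | t :: l => D.s t (run v l)

/-- Every move of the list raises the rank. -/
def Legal (v : D.V) : List I → Prop
  | [] => True
  | t :: l => Legal v l ∧ ¬ D.neg t (D.run v l)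

theorem rk_run {v : D.V} : ∀ {l : List I}, D.Legal v l → D.rk (D.run v l) = D.rk v + l.length
  | [], _ => rfl
  | t :: l, h => by
    rw [run, D.rk_s _ _ h.2, rk_run h.1, List.length_cons, add_assoc]

/-- The relations between the vertex groups act trivially for a suitable choice of panels. -/
theorem exists_action [∀ i, Nontrivial (G i)] (rel : I → I → Set (CoprodI G))
    (hsymm : ∀ i j, rel i j = rel j i)
    (hletters : ∀ i j, i ≠ j → ∀ r ∈ rel i j, ∃ l : List (Σ t, G t),
      (∀ x ∈ l, x.1 = i ∨ x.1 = j) ∧ letterProd l = r)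
    (hk : ∀ i j, i ≠ j → D.k i j ≠ 0 → 2 ≤ D.k i j)
    (hgirth : ∀ i j, i ≠ j → ∀ l : List (Σ t, G t), (∀ x ∈ l, x.1 = i ∨ x.1 = j) →
      (D.k i j ≠ 0 → l.length < 2 * D.k i j) →
      letterProd l ∈ Subgroup.normalClosure (rel i j) → letterProd l = 1) :
    ∃ ρ : D.V → Panels G (List (D.V ⊕ CoprodI G)),
      ∀ i j, i ≠ j → ∀ r ∈ rel i j, D.toPerm ρ r = 1 := by
  classical
  have hdefault : ∀ i, ∃ φ : G i →*
      Equiv.Perm (List (D.V ⊕ CoprodI G) ⊕ List (D.V ⊕ CoprodI G)), IsPanel φ := by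
    intro i
    obtain ⟨g₀, hg₀⟩ := exists_ne (1 : G i)
    obtain ⟨e⟩ : Nonempty (List (D.V ⊕ CoprodI G) ≃ {g : G i // g ≠ 1} × List (D.V ⊕ CoprodI G)) :=
      Function.Embedding.antisymm ⟨fun ω => (⟨g₀, hg₀⟩, ω), fun ω ω' h => (Prod.ext_iff.1 h).2⟩
        ⟨fun p => Sum.inr (CoprodI.of p.1.1) :: p.2, by
          rintro ⟨⟨g, hg⟩, ω⟩ ⟨⟨g', hg'⟩, ω'⟩ h
          simp only [List.cons.injEq, Sum.inr.injEq] at h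
          simp only [CoprodI.of_injective _ h.1, h.2]⟩
    exact exists_isPanel e
  have hκ : ∀ N : Subgroup (CoprodI G), Nonempty
      (((D.V × List (D.V ⊕ CoprodI G)) ⊕ List (D.V ⊕ CoprodI G)) × (CoprodI G ⧸ N) ↪
        List (D.V ⊕ CoprodI G)) := by
    refine fun N => ⟨⟨fun p => Sum.elim (fun q => Sum.inl q.1 :: Sum.inr p.2.out :: q.2)
      (fun ω => Sum.inr p.2.out :: ω) p.1, ?_⟩⟩
    have hout : ∀ a b : CoprodI G ⧸ N, a.out = b.out → a = b := fun a b h => by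
      rw [← Quotient.out_eq a, ← Quotient.out_eq b, h]
    rintro ⟨⟨v, ω⟩ | ω, h⟩ ⟨⟨v', ω'⟩ | ω', h'⟩ hh
    · simp only [Sum.elim_inl, List.cons.injEq, Sum.inl.injEq, Sum.inr.injEq] at hh
      rw [hh.1, hh.2.2, hout _ _ hh.2.1]
    · simp at hh
    · simp at hh
    · simp only [Sum.elim_inr, List.cons.injEq, Sum.inr.injEq] at hh
      rw [hh.2, hout _ _ hh.1]
  set Ω := List (D.V ⊕ CoprodI G)
  choose φ₀ hφ₀ using hdefault
  obtain ⟨ρ, hρ⟩ := exists_of_local (X := fun _ => Panels G Ω) D.rk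
    (fun w (ρ : D.V → Panels G Ω) => ∀ i j, i ≠ j → D.neg i w → D.neg j w → ∀ r ∈ rel i j,
      ∀ z, Orb D.s i j w z.1 → D.toPerm ρ r z = z)
    (fun _ i => ⟨φ₀ i, hφ₀ i⟩) (by
      intro w f f' hff h i j hij hi hj r hr z hz
      have hagree : ∀ l : List (Σ t, G t), (∀ x ∈ l, x.1 = i ∨ x.1 = j) →
          Orb D.s i j w (D.toPerm f (letterProd l) z).1 ∧
            D.toPerm f (letterProd l) z = D.toPerm f' (letterProd l) z := by
        intro l
        induction l with
        | nil => intro _; simpa using hz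
        | cons x l ih =>
          intro hl
          obtain ⟨a, b⟩ := ih fun y hy => hl y (List.mem_cons_of_mem _ hy)
          have hs : ∀ u, Orb D.s i j w u → Orb D.s i j w (D.s x.1 u) := fun u hu => by
            rcases hl x List.mem_cons_self with h | h
            · exact hu.tail (Or.inl (by rw [h]))
            · exact hu.tail (Or.inr (by rw [h]))
          simp only [letterProd_cons, map_mul, toPerm_of, Equiv.Perm.mul_apply]
          rw [← b]
          set z' := D.toPerm f (letterProd l) z
          constructor
          · rcases D.act_fst_cases f x.1 x.2 z' with h | h
            · rw [h]; exact a
            · rw [h]; exact hs _ a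
          · refine D.act_congr (congrFun (hff _ ?_) _)
            have : Orb D.s i j w (D.enc x.1 z').1 := by
              rcases D.enc_fst x.1 z' with h | h
              · rw [h]; exact a
              · rw [h]; exact hs _ a
            exact (D.top i j w _ hij hi hj this).elim Or.inr fun h => Or.inl h.2
      obtain ⟨l, hl, rfl⟩ := hletters i j hij r hr
      rw [← (hagree l hl).2]
      exact h i j hij hi hj _ hr z hz)
    (by
      intro w f
      by_cases hw : ∃ i j, i ≠ j ∧ D.neg i w ∧ D.neg j w
      · obtain ⟨i, j, hij, hi, hj⟩ := hw
        obtain ⟨κ⟩ := hκ (Subgroup.normalClosure (rel i j))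
        have hk0 := D.k_ne_zero i j w hij hi hj
        obtain ⟨x, hx⟩ := D.exists_panels f hij hi hj (Subgroup.normalClosure (rel i j))
          (hk i j hij hk0) (fun l hl hn => hgirth i j hij l hl fun _ => hn) κ
        refine ⟨x, ?_⟩
        have key : ∀ r ∈ rel i j, ∀ z, Orb D.s i j w z.1 →
            D.toPerm (Function.update f w x) r z = z := by
          intro r hr z hz
          obtain ⟨l, hl, rfl⟩ := hletters i j hij r hr
          exact hx (Function.update f w x) (Function.update_self ..)
            (fun u hu => Function.update_of_ne hu ..) l hl (Subgroup.subset_normalClosure hr) z hz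
        intro i' j' hij' hi' hj' r hr z hz
        have hmem : ∀ t, D.neg t w → t = i ∨ t = j := by
          intro t ht
          by_contra! h
          exact D.not_three i j t w hij (Ne.symm h.2) (Ne.symm h.1) hi hj ht
        rcases hmem i' hi' with rfl | rfl <;> rcases hmem j' hj' with rfl | rfl
        · exact absurd rfl hij'
        · exact key r hr z hz
        · refine key r (by rwa [hsymm]) z (by
            unfold Orb at hz ⊢
            exact Relation.ReflTransGen.mono (fun a b h => Or.symm h) _ _ hz)
        · exact absurd rfl hij'
      · exact ⟨f w, fun i j hij hi hj => absurd ⟨i, j, hij, hi, hj⟩ hw⟩)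
  refine ⟨ρ, fun i j hij r hr => ?_⟩
  by_cases h0 : D.k i j = 0
  · obtain ⟨l, hl, rfl⟩ := hletters i j hij r hr
    rw [hgirth i j hij l hl (fun h => absurd h0 h) (Subgroup.subset_normalClosure hr), map_one]
  · ext1 z
    obtain ⟨w, hw, hi, hj⟩ := D.exists_top i j z.1 hij h0
    exact hρ w i j hij hi hj r hr z hw

/-- Words whose types form a legal sequence of moves survive modulo the relations. -/
theorem letterProd_notMem [∀ i, Nontrivial (G i)] (rel : I → I → Set (CoprodI G))
    (hsymm : ∀ i j, rel i j = rel j i)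
    (hletters : ∀ i j, i ≠ j → ∀ r ∈ rel i j, ∃ l : List (Σ t, G t),
      (∀ x ∈ l, x.1 = i ∨ x.1 = j) ∧ letterProd l = r)
    (hk : ∀ i j, i ≠ j → D.k i j ≠ 0 → 2 ≤ D.k i j)
    (hgirth : ∀ i j, i ≠ j → ∀ l : List (Σ t, G t), (∀ x ∈ l, x.1 = i ∨ x.1 = j) →
      (D.k i j ≠ 0 → l.length < 2 * D.k i j) →
      letterProd l ∈ Subgroup.normalClosure (rel i j) → letterProd l = 1)
    (hloop : ∀ i, rel i i = ∅) (v : D.V) {l : List (Σ t, G t)} (hl : l ≠ [])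
    (hl₁ : ∀ x ∈ l, x.2 ≠ 1) (hlegal : D.Legal v (l.map Sigma.fst)) :
    letterProd l ∉ Subgroup.normalClosure (⋃ (i : I) (j : I), rel i j) := by
  intro hmem
  obtain ⟨ρ, hρ⟩ := D.exists_action rel hsymm hletters hk hgirth
  have hker : Subgroup.normalClosure (⋃ (i : I) (j : I), rel i j) ≤ (D.toPerm ρ).ker := by
    refine Subgroup.normalClosure_le_normal fun r hr => ?_
    simp only [Set.mem_iUnion] at hr
    obtain ⟨i, j, hr⟩ := hr
    by_cases hij : i = j
    · subst hij; rw [hloop] at hr; exact hr.elim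
    · exact hρ i j hij r hr
  have h1 : D.toPerm ρ (letterProd l) (v, []) = (v, []) := by
    rw [MonoidHom.mem_ker.1 (hker hmem)]; rfl
  have h2 : ∀ l : List (Σ t, G t), (∀ x ∈ l, x.2 ≠ 1) → D.Legal v (l.map Sigma.fst) →
      (D.toPerm ρ (letterProd l) (v, [])).1 = D.run v (l.map Sigma.fst) := by
    intro l
    induction l with
    | nil => intros; simp [run]
    | cons x l ih =>
      intro hl h
      have e := ih (fun y hy => hl y (List.mem_cons_of_mem _ hy)) h.1
      simp only [letterProd_cons, map_mul, toPerm_of, Equiv.Perm.mul_apply, List.map_cons, run]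
      rw [D.act_fst ρ (hl x List.mem_cons_self) (by rw [e]; exact h.2), e]
  have h3 := D.rk_run hlegal
  rw [← h2 l hl₁ hlegal, h1, List.length_map] at h3
  exact hl (List.eq_nil_of_length_eq_zero (by simpa using h3))

end ChamberGame

/-! ### Lengths in free products -/

section Length

variable {A B : Type*} [Group A] [Group B]

/-- The element of the free product given by a letter. -/
def letter (x : A ⊕ B) : Coprod A B := Sum.elim Coprod.inl Coprod.inr x

/-- The product in the free product of a list of letters from the factors. -/
def wordProd (l : List (A ⊕ B)) : Coprod A B := (l.map letter).prod

theorem fpLength_wordProd_le (l : List (A ⊕ B)) : fpLength (wordProd l) ≤ l.length := by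
  refine Nat.sInf_le ⟨l.map letter, by simp, rfl, fun w hw => ?_⟩
  obtain ⟨a | b, -, rfl⟩ := List.mem_map.1 hw
  · exact Or.inl ⟨a, rfl⟩
  · exact Or.inr ⟨b, rfl⟩

theorem exists_wordProd_of_letters (l : List (Coprod A B))
    (hl : ∀ w ∈ l, (∃ a : A, Coprod.inl a = w) ∨ ∃ b : B, Coprod.inr b = w) :
    ∃ l' : List (A ⊕ B), l'.length = l.length ∧ wordProd l' = l.prod := by
  induction l with
  | nil => exact ⟨[], rfl, rfl⟩
  | cons w l ih =>
    obtain ⟨l', h, h'⟩ := ih fun w hw => hl w (List.mem_cons_of_mem _ hw)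
    rcases hl w List.mem_cons_self with ⟨a, rfl⟩ | ⟨b, rfl⟩
    · exact ⟨Sum.inl a :: l', by simp [h], by simp [wordProd, letter, ← h']⟩
    · exact ⟨Sum.inr b :: l', by simp [h], by simp [wordProd, letter, ← h']⟩

theorem exists_wordProd (x : Coprod A B) : ∃ l : List (A ⊕ B), wordProd l = x := by
  induction x using Coprod.induction_on with
  | inl a => exact ⟨[Sum.inl a], by simp [wordProd, letter]⟩
  | inr b => exact ⟨[Sum.inr b], by simp [wordProd, letter]⟩
  | mul x y hx hy =>
    obtain ⟨l, rfl⟩ := hx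
    obtain ⟨l', rfl⟩ := hy
    exact ⟨l ++ l', by simp [wordProd]⟩

theorem exists_minimal_word (x : Coprod A B) :
    ∃ l : List (A ⊕ B), wordProd l = x ∧ l.length = fpLength x := by
  obtain ⟨l, hl⟩ := exists_wordProd x
  have hne : {n | ∃ l : List (Coprod A B), l.length = n ∧ l.prod = x ∧
      ∀ w ∈ l, (∃ a : A, Coprod.inl a = w) ∨ (∃ b : B, Coprod.inr b = w)}.Nonempty := by
    refine ⟨_, l.map letter, rfl, hl, fun w hw => ?_⟩
    obtain ⟨a | b, -, rfl⟩ := List.mem_map.1 hw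
    · exact Or.inl ⟨a, rfl⟩
    · exact Or.inr ⟨b, rfl⟩
  obtain ⟨l', h₁, h₂, h₃⟩ := Nat.sInf_mem hne
  obtain ⟨l'', h, h'⟩ := exists_wordProd_of_letters l' h₃
  exact ⟨l'', h'.trans h₂, h.trans h₁⟩

theorem exists_merge {a b : A ⊕ B} (h : a.isLeft = b.isLeft) :
    ∃ c : A ⊕ B, letter c = letter a * letter b := by
  rcases a with a | a <;> rcases b with b | b <;> simp at h
  · exact ⟨Sum.inl (a * b), by simp [letter]⟩
  · exact ⟨Sum.inr (a * b), by simp [letter]⟩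

theorem exists_shorter_or_getLast (l : List (A ⊕ B)) (a : A ⊕ B) :
    (∃ l' : List (A ⊕ B), l'.length = l.length ∧ wordProd l' = wordProd (a :: l)) ∨
      ((a :: l).getLast (List.cons_ne_nil _ _)).isLeft =
        (if Even l.length then a.isLeft else !a.isLeft) := by
  induction l generalizing a with
  | nil => simp
  | cons b l ih =>
    by_cases hab : a.isLeft = b.isLeft
    · obtain ⟨c, hc⟩ := exists_merge hab
      exact Or.inl ⟨c :: l, by simp, by simp [wordProd, hc, mul_assoc]⟩
    · rcases ih b with ⟨l', h, h'⟩ | h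
      · refine Or.inl ⟨a :: l', by simp [h], ?_⟩
        simpa [wordProd] using h'
      · right
        rw [List.getLast_cons (List.cons_ne_nil _ _), h]
        have hb : b.isLeft = !a.isLeft := by
          cases h1 : a.isLeft <;> cases h2 : b.isLeft <;> simp_all
        by_cases he : Even l.length <;> simp [he, hb, Nat.even_add_one]

/-- An odd word of length at least two is conjugate to a shorter word. -/
theorem exists_shorter_conj {l : List (A ⊕ B)} (hl : Odd l.length) (h2 : 2 ≤ l.length) :
    ∃ (l' : List (A ⊕ B)) (g : Coprod A B), l'.length < l.length ∧
      wordProd l' = g * wordProd l * g⁻¹ := by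
  obtain _ | ⟨a, l⟩ := l
  · simp at h2
  have he : Even l.length := by
    rw [List.length_cons, Nat.odd_add_one, Nat.not_odd_iff_even] at hl; exact hl
  rcases exists_shorter_or_getLast l a with ⟨l', h, h'⟩ | h
  · exact ⟨l', 1, by simp [h], by simp [h']⟩
  · have hne : l ≠ [] := by rintro rfl; simp at h2
    rw [List.getLast_cons hne, if_pos he] at h
    obtain ⟨c, hc⟩ := exists_merge h
    refine ⟨l.dropLast ++ [c], (letter a)⁻¹, ?_, ?_⟩
    · have := List.length_pos_iff.2 hne
      simp; omega
    · have : wordProd l = wordProd l.dropLast * letter (l.getLast hne) := by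
        conv_lhs => rw [← List.dropLast_append_getLast hne]
        simp [wordProd]
      have h3 : wordProd (a :: l) = letter a * wordProd l := by simp [wordProd]
      rw [h3, this]
      have h4 : wordProd (l.dropLast ++ [c]) = wordProd l.dropLast * letter c := by
        simp [wordProd]
      rw [h4, hc]
      group

theorem eq_one_of_fpLength {x : Coprod A B} (h : fpLength x = 0) : x = 1 := by
  obtain ⟨l, hl, hl'⟩ := exists_minimal_word x
  rw [h] at hl'
  rw [← hl, List.eq_nil_of_length_eq_zero hl']
  rfl

theorem fpLength_swap_le (x : Coprod A B) : fpLength (Coprod.swap A B x) ≤ fpLength x := by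
  obtain ⟨l, hl, hl'⟩ := exists_minimal_word x
  have : Coprod.swap A B x = wordProd (l.map Sum.swap) := by
    rw [← hl, wordProd, wordProd, map_list_prod, List.map_map, List.map_map]
    congr 2
    ext1 (a | b) <;> simp [letter]
  rw [this, ← hl']
  simpa using fpLength_wordProd_le (l.map Sum.swap)

theorem fpLength_swap (x : Coprod A B) : fpLength (Coprod.swap A B x) = fpLength x :=
  (fpLength_swap_le x).antisymm (by simpa using fpLength_swap_le (Coprod.swap A B x))

theorem exists_minRel {N : Subgroup (Coprod A B)} (hN : ∃ x ∈ N, x ≠ 1) :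
    ∃ x ∈ N, x ≠ 1 ∧ fpLength x = minRelLength N := by
  obtain ⟨x, hx⟩ := hN
  obtain ⟨y, ⟨hy, hy1⟩, h⟩ := Nat.sInf_mem
    (Set.Nonempty.image fpLength (⟨x, hx⟩ : {x | x ∈ N ∧ x ≠ 1}.Nonempty))
  exact ⟨y, hy, hy1, h⟩

theorem minRelLength_le {N : Subgroup (Coprod A B)} {x : Coprod A B} (hx : x ∈ N) (h : x ≠ 1) :
    minRelLength N ≤ fpLength x := Nat.sInf_le ⟨x, ⟨hx, h⟩, rfl⟩

theorem four_le_minRelLength {N : Subgroup (Coprod A B)} (hN : ∃ x ∈ N, x ≠ 1)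
    (h : gsAngle N ≤ Real.pi / 2) : 4 ≤ minRelLength N := by
  obtain ⟨x, hx, hx1, hm⟩ := exists_minRel hN
  have h0 : 0 < minRelLength N := by
    rw [← hm]
    exact Nat.pos_of_ne_zero fun h => hx1 (eq_one_of_fpLength h)
  have h0' : (0 : ℝ) < minRelLength N := by exact_mod_cast h0
  rw [gsAngle, if_pos hN, div_le_iff₀ h0'] at h
  have : (4 : ℝ) ≤ minRelLength N := by nlinarith [Real.pi_pos]
  exact_mod_cast this

theorem even_minRelLength {N : Subgroup (Coprod A B)} [N.Normal] (hN : ∃ x ∈ N, x ≠ 1)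
    (h : 2 ≤ minRelLength N) : Even (minRelLength N) := by
  by_contra hodd
  obtain ⟨x, hx, hx1, hm⟩ := exists_minRel hN
  obtain ⟨l, hl, hl'⟩ := exists_minimal_word x
  obtain ⟨l', g, h₁, h₂⟩ := exists_shorter_conj (l := l)
    (by rw [hl', hm]; exact Nat.not_even_iff_odd.1 hodd) (by omega)
  have h₃ : wordProd l' ∈ N := by rw [h₂, hl]; exact Subgroup.Normal.conj_mem ‹_› x hx g
  have h₄ : wordProd l' ≠ 1 := by rw [h₂, hl]; simpa using hx1
  have := minRelLength_le h₃ h₄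
  have := fpLength_wordProd_le l'
  omega

theorem image_fpLength_subset {N : Subgroup (Coprod A B)} {N' : Subgroup (Coprod B A)}
    (h : ∀ x ∈ N, Coprod.swap A B x ∈ N') :
    fpLength '' {x | x ∈ N ∧ x ≠ 1} ⊆ fpLength '' {x | x ∈ N' ∧ x ≠ 1} := by
  rintro _ ⟨x, ⟨hx, hx1⟩, rfl⟩
  refine ⟨Coprod.swap A B x, ⟨h x hx, fun h1 => hx1 ?_⟩, fpLength_swap x⟩
  have := congrArg (Coprod.swap B A) h1
  simpa using this

theorem minRelLength_swap {N : Subgroup (Coprod A B)} {N' : Subgroup (Coprod B A)}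
    (h : ∀ x ∈ N, Coprod.swap A B x ∈ N') (h' : ∀ x ∈ N', Coprod.swap B A x ∈ N) :
    minRelLength N = minRelLength N' :=
  congrArg sInf ((image_fpLength_subset h).antisymm (image_fpLength_subset h'))

theorem minRelLength_eq_zero {N : Subgroup (Coprod A B)} (hN : ¬ ∃ x ∈ N, x ≠ 1) :
    minRelLength N = 0 := by
  have : {x | x ∈ N ∧ x ≠ 1} = ∅ := Set.eq_empty_of_forall_notMem fun x hx => hN ⟨x, hx⟩
  rw [minRelLength, this, Set.image_empty, Nat.sInf_empty]

theorem gsAngle_eq (N : Subgroup (Coprod A B)) :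
    gsAngle N = 2 * Real.pi / (minRelLength N : ℝ) := by
  by_cases hN : ∃ x ∈ N, x ≠ 1
  · rw [gsAngle, if_pos hN]
  · rw [gsAngle, if_neg hN, minRelLength_eq_zero hN, Nat.cast_zero, div_zero]

end Length

/-! ### Labels of a non-spherical Pride group -/

/-- The largest of the labels `2`, `3`, `4`, `6` that is at most `m / 2`; the label `0` stands
for infinity. -/
def labelOf (m : ℕ) : ℕ :=
  if m = 0 then 0 else if m < 6 then 2 else if m < 8 then 3 else if m < 12 then 4 else 6

theorem labelOf_cases {m : ℕ} (h : m = 0 ∨ 4 ≤ m ∧ Even m) :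
    (labelOf m = 0 ∧ m = 0) ∨ (labelOf m = 2 ∧ m = 4) ∨ (labelOf m = 3 ∧ m = 6) ∨
      (labelOf m = 4 ∧ 8 ≤ m ∧ m ≤ 10) ∨ (labelOf m = 6 ∧ 12 ≤ m) := by
  unfold labelOf
  rcases h with rfl | ⟨h, n, rfl⟩
  · simp
  · split_ifs <;> omega

theorem label_bounds {m : ℕ} (h : m = 0 ∨ 4 ≤ m ∧ Even m) :
    (labelOf m = 0 ∧ (1 / m : ℝ) = 0) ∨ (labelOf m = 2 ∧ (1 / m : ℝ) = 1 / 4) ∨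
      (labelOf m = 3 ∧ (1 / m : ℝ) = 1 / 6) ∨ (labelOf m = 4 ∧ 1 / 10 ≤ (1 / m : ℝ)) ∨
      (labelOf m = 6 ∧ 0 < (1 / m : ℝ)) := by
  rcases labelOf_cases h with ⟨e, h⟩ | ⟨e, h⟩ | ⟨e, h⟩ | ⟨e, h, h'⟩ | ⟨e, h⟩ <;> simp only [e]
  · simp [h]
  · norm_num [h]
  · norm_num [h]
  · have h1 : (0 : ℝ) < m := by exact_mod_cast (by omega : 0 < m)
    have h2 : (m : ℝ) ≤ 10 := by exact_mod_cast h'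
    simp [inv_anti₀ h1 h2]
  · have h1 : (0 : ℝ) < m := by exact_mod_cast (by omega : 0 < m)
    simp [h1]

theorem label_triple {a b c : ℕ} (ha : a = 0 ∨ 4 ≤ a ∧ Even a) (hb : b = 0 ∨ 4 ≤ b ∧ Even b)
    (hc : c = 0 ∨ 4 ≤ c ∧ Even c) (h : (1 / a + 1 / b + 1 / c : ℝ) ≤ 1 / 2) :
    (1 / labelOf a + 1 / labelOf b + 1 / labelOf c : ℚ) ≤ 1 := by
  rcases label_bounds ha with ⟨e, h₁⟩ | ⟨e, h₁⟩ | ⟨e, h₁⟩ | ⟨e, h₁⟩ | ⟨e, h₁⟩ <;>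
  rcases label_bounds hb with ⟨e', h₂⟩ | ⟨e', h₂⟩ | ⟨e', h₂⟩ | ⟨e', h₂⟩ | ⟨e', h₂⟩ <;>
  rcases label_bounds hc with ⟨e'', h₃⟩ | ⟨e'', h₃⟩ | ⟨e'', h₃⟩ | ⟨e'', h₃⟩ | ⟨e'', h₃⟩ <;>
  rw [e, e', e''] <;> first | (norm_num; done) | (exfalso; linarith)

section Labels

variable {I : Type*} {G : I → Type*} [∀ i, Group (G i)]

theorem exists_retraction {i j : I} (hij : i ≠ j) :
    ∃ π : CoprodI G →* Coprod (G i) (G j), (∀ g : G i, π (CoprodI.of g) = Coprod.inl g) ∧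
      ∀ g : G j, π (CoprodI.of g) = Coprod.inr g := by
  classical
  let f : ∀ t, G t →* Coprod (G i) (G j) :=
    Function.update (β := fun t => G t →* Coprod (G i) (G j))
      (Function.update (β := fun t => G t →* Coprod (G i) (G j)) (fun _ => 1) j Coprod.inr)
      i Coprod.inl
  have h₁ : f i = Coprod.inl := Function.update_self ..
  have h₂ : f j = Coprod.inr := by
    simp only [f]
    rw [Function.update_of_ne hij.symm, Function.update_self]
  exact ⟨CoprodI.lift f, fun g => by rw [CoprodI.lift_of, h₁], fun g => by
    rw [CoprodI.lift_of, h₂]⟩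

theorem exists_wordProd_of_letterProd {i j : I} (l : List (Σ t, G t))
    (hl : ∀ x ∈ l, x.1 = i ∨ x.1 = j) :
    ∃ l' : List (G i ⊕ G j), l'.length = l.length ∧
      edgeEmb G i j (wordProd l') = ChamberGame.letterProd l := by
  induction l with
  | nil => exact ⟨[], rfl, by simp [wordProd]⟩
  | cons x l ih =>
    obtain ⟨l', h, h'⟩ := ih fun x hx => hl x (List.mem_cons_of_mem _ hx)
    obtain ⟨t, g⟩ := x
    rcases hl _ List.mem_cons_self with rfl | rfl
    · exact ⟨Sum.inl g :: l', by simp [h], by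
        simp [← h', wordProd, letter, edgeEmb]⟩
    · exact ⟨Sum.inr g :: l', by simp [h], by
        simp [← h', wordProd, letter, edgeEmb]⟩

theorem exists_letterProd (i j : I) (x : Coprod (G i) (G j)) :
    ∃ l : List (Σ t, G t), (∀ x ∈ l, x.1 = i ∨ x.1 = j) ∧
      ChamberGame.letterProd l = edgeEmb G i j x := by
  induction x using Coprod.induction_on with
  | inl a => exact ⟨[⟨i, a⟩], by simp, by simp [edgeEmb]⟩
  | inr b => exact ⟨[⟨j, b⟩], by simp, by simp [edgeEmb]⟩
  | mul x y hx hy =>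
    obtain ⟨l, h, h'⟩ := hx
    obtain ⟨l', k, k'⟩ := hy
    refine ⟨l ++ l', fun z hz => ?_, by simp [h', k']⟩
    exact (List.mem_append.1 hz).elim (h z) (k z)

theorem edgeEmb_swap {i j : I} (x : Coprod (G i) (G j)) :
    edgeEmb G j i (Coprod.swap (G i) (G j) x) = edgeEmb G i j x := by
  have : (edgeEmb G j i).comp (Coprod.swap (G i) (G j)) = edgeEmb G i j := by
    ext <;> simp [edgeEmb]
  exact DFunLike.congr_fun this x

/-- A short word in two vertex groups that is trivial in the edge group is trivial. -/
theorem letterProd_eq_one {i j : I} (hij : i ≠ j) {S : Set (Coprod (G i) (G j))}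
    (l : List (Σ t, G t)) (hl : ∀ x ∈ l, x.1 = i ∨ x.1 = j)
    (hlen : minRelLength (Subgroup.normalClosure S) ≠ 0 →
      l.length < minRelLength (Subgroup.normalClosure S))
    (h : ChamberGame.letterProd l ∈ Subgroup.normalClosure (edgeEmb G i j '' S)) :
    ChamberGame.letterProd l = 1 := by
  obtain ⟨π, h₁, h₂⟩ := exists_retraction (G := G) hij
  obtain ⟨l', hl', e⟩ := exists_wordProd_of_letterProd l hl
  have hπ : ∀ x, π (edgeEmb G i j x) = x := by
    have : π.comp (edgeEmb G i j) = MonoidHom.id _ := by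
      ext <;> simp [edgeEmb, h₁, h₂]
    exact DFunLike.congr_fun this
  have hle : Subgroup.normalClosure (edgeEmb G i j '' S) ≤
      (Subgroup.normalClosure S).comap π := by
    refine Subgroup.normalClosure_le_normal ?_
    rintro _ ⟨x, hx, rfl⟩
    rw [SetLike.mem_coe, Subgroup.mem_comap, hπ]
    exact Subgroup.subset_normalClosure hx
  have hmem : wordProd l' ∈ Subgroup.normalClosure S := by
    have := hle h
    rwa [← e, Subgroup.mem_comap, hπ] at this
  by_cases h1 : wordProd l' = 1
  · rw [← e, h1, map_one]
  · exfalso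
    have h3 := minRelLength_le hmem h1
    have h4 := fpLength_wordProd_le l'
    have h5 : minRelLength (Subgroup.normalClosure S) ≠ 0 := by
      obtain ⟨x, -, hx, hx'⟩ := exists_minRel ⟨_, hmem, h1⟩
      rw [← hx']
      exact fun h => hx (eq_one_of_fpLength h)
    have := hlen h5
    omega

theorem exists_labelling {R : ∀ i j : I, Set (Coprod (G i) (G j))} (hR : IsPrideData G R)
    (hNS : NonSpherical G R) :
    ∃ k : I → I → ℕ, NumbersGame.IsLabelling k ∧ ∀ i j, i ≠ j → ∀ l : List (Σ t, G t),
      (∀ x ∈ l, x.1 = i ∨ x.1 = j) → (k i j ≠ 0 → l.length < 2 * k i j) →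
      ChamberGame.letterProd l ∈ Subgroup.normalClosure (edgeEmb G i j '' R i j) →
      ChamberGame.letterProd l = 1 := by
  set m : I → I → ℕ := fun i j => minRelLength (Subgroup.normalClosure (R i j)) with hm
  have hm4 : ∀ i j, i ≠ j → m i j = 0 ∨ 4 ≤ m i j ∧ Even (m i j) := by
    intro i j hij
    by_cases hN : ∃ x ∈ Subgroup.normalClosure (R i j), x ≠ 1
    · have := four_le_minRelLength hN (hNS.1 i j hij)
      exact Or.inr ⟨this, even_minRelLength hN (by omega)⟩
    · exact Or.inl (minRelLength_eq_zero hN)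
  have hmsymm : ∀ i j, m i j = m j i := by
    have key : ∀ i j, ∀ x ∈ Subgroup.normalClosure (R i j),
        Coprod.swap (G i) (G j) x ∈ Subgroup.normalClosure (R j i) := by
      intro i j
      have : Subgroup.normalClosure (R i j) ≤
          (Subgroup.normalClosure (R j i)).comap (Coprod.swap (G i) (G j)) := by
        refine Subgroup.normalClosure_le_normal fun x hx => ?_
        refine Subgroup.subset_normalClosure ?_
        rw [← hR.2.1 i j]
        exact ⟨x, hx, rfl⟩
      exact this
    exact fun i j => minRelLength_swap (key i j) (key j i)
  refine ⟨fun i j => labelOf (m i j), ⟨fun i j => by rw [hmsymm], fun i j hij => ?_,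
    fun i j l hij hjl hil => ?_⟩, fun i j hij l hl hlen h => ?_⟩
  · rcases labelOf_cases (hm4 i j hij) with h | h | h | h | h <;> simp [h.1]
  · refine label_triple (hm4 i j hij) (hm4 j l hjl) (hm4 i l hil) ?_
    have := hNS.2 i j l hij hjl hil
    rw [gsAngle_eq, gsAngle_eq, gsAngle_eq] at this
    change 2 * Real.pi / (m i j : ℝ) + 2 * Real.pi / (m j l : ℝ) +
      2 * Real.pi / (m i l : ℝ) ≤ Real.pi at this
    have h2 : 2 * Real.pi * (1 / (m i j : ℝ) + 1 / (m j l : ℝ) + 1 / (m i l : ℝ)) ≤ Real.pi := by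
      refine le_trans (le_of_eq ?_) this
      ring
    nlinarith [Real.pi_pos]
  · refine letterProd_eq_one hij l hl (fun h0 => ?_) h
    change l.length < m i j
    change m i j ≠ 0 at h0
    rcases labelOf_cases (hm4 i j hij) with h | h | h | h | h <;> simp only [h.1] at hlen <;> omega

end Labels

/-! ### Free subgroups from words in three letters -/

/-- If all words in three elements and their inverses in which consecutive letters have different
indices are nontrivial, then the group contains a free subgroup of rank two. -/
theorem exists_injective_of_words {P : Type*} [Group P] (e : Fin 3 → P)
    (he : ∀ L : List (Fin 3 × Bool), L ≠ [] → L.IsChain (fun a b => a.1 ≠ b.1) →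
      (L.map fun x => cond x.2 (e x.1) (e x.1)⁻¹).prod ≠ 1) :
    ∃ f : FreeGroup (Fin 2) →* P, Function.Injective f := by
  let u : Fin 2 → P := fun i => e 0 * e i.succ
  have hs : ∀ i : Fin 2, (0 : Fin 3) ≠ i.succ := fun i => (Fin.succ_ne_zero i).symm
  have key : ∀ (w : List (Fin 2 × Bool)) (x : Fin 2 × Bool), FreeGroup.IsReduced (x :: w) →
      ∃ L : List (Fin 3 × Bool),
        (cond x.2 [(0, true), (x.1.succ, true)] [(x.1.succ, false)] ++ L).IsChain
          (fun a b => a.1 ≠ b.1) ∧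
        ((cond x.2 [(0, true), (x.1.succ, true)] [(x.1.succ, false)] ++ L).map
          fun x => cond x.2 (e x.1) (e x.1)⁻¹).prod =
        ((x :: w).map fun x => cond x.2 (u x.1) (u x.1)⁻¹).prod := by
    intro w
    induction w with
    | nil =>
      rintro ⟨i, b⟩ -
      cases b
      · exact ⟨[(0, false)], by simp [hs], by simp [u]⟩
      · exact ⟨[], by simp [hs], by simp [u]⟩
    | cons y w ih =>
      rintro ⟨i, b⟩ h
      obtain ⟨j, c⟩ := y
      rw [FreeGroup.isReduced_cons_cons] at h
      obtain ⟨L, hL, hL'⟩ := ih _ h.2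
      have hne : b ≠ c → i.succ ≠ j.succ := fun hbc hij =>
        hbc (h.1 (Fin.succ_injective _ hij))
      rw [List.map_cons, List.prod_cons, ← hL']
      cases b <;> cases c <;>
        simp only [cond_true, cond_false, List.cons_append, List.nil_append,
          List.isChain_cons_cons] at hL ⊢
      · exact ⟨(0, false) :: (j.succ, false) :: L, by simp [hs, hL],
          by simp [u, mul_assoc]⟩
      · refine ⟨(j.succ, true) :: L, ?_, by simp [u, mul_assoc]⟩
        simp only [List.isChain_cons_cons]
        exact ⟨hne (by simp), hL.2⟩
      · refine ⟨(j.succ, false) :: L, ?_, by simp [u, mul_assoc]⟩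
        simp only [List.isChain_cons_cons]
        exact ⟨hs i, hne (by simp), hL⟩
      · refine ⟨(0, true) :: (j.succ, true) :: L, ?_, by simp [u, mul_assoc]⟩
        simp only [List.isChain_cons_cons]
        exact ⟨hs i, (hs i).symm, hL⟩
  refine ⟨FreeGroup.lift u, (injective_iff_map_eq_one _).2 fun x hx => ?_⟩
  by_contra h1
  rw [← FreeGroup.mk_toWord (x := x), FreeGroup.lift_mk] at hx
  have hred := FreeGroup.isReduced_toWord (x := x)
  rcases hw : x.toWord with _ | ⟨y, w⟩
  · exact h1 (FreeGroup.toWord_eq_nil_iff.1 hw)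
  · rw [hw] at hx hred
    obtain ⟨L, hL, hL'⟩ := key w y hred
    exact he _ (by cases y.2 <;> simp) hL (hL'.trans hx)

namespace NumbersGame

variable {I : Type*}

/-- The result of firing the entries of a list, last entry first. -/
noncomputable def runFire (c : I → I → ℝ) (μ : I → ℝ) : List I → I → ℝ
  | [] => μ
  | t :: l => fire c t (runFire c μ l)

/-- Each entry of the list is fired at a positive coordinate. -/
def LegalAt (c : I → I → ℝ) (μ : I → ℝ) : List I → Prop
  | [] => True
  | t :: l => LegalAt c μ l ∧ 0 < runFire c μ l t

theorem runFire_append (c : I → I → ℝ) (μ : I → ℝ) (l l' : List I) :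
    runFire c μ (l ++ l') = runFire c (runFire c μ l') l := by
  induction l with
  | nil => rfl
  | cons t l ih => simp [runFire, ih]

theorem legalAt_append (c : I → I → ℝ) (μ : I → ℝ) (l l' : List I) :
    LegalAt c μ (l ++ l') ↔ LegalAt c μ l' ∧ LegalAt c (runFire c μ l') l := by
  induction l with
  | nil => simp [LegalAt]
  | cons t l ih => simp [LegalAt, ih, runFire_append, and_assoc]

variable {k : I → I → ℕ} (hk : IsLabelling k)

theorem run_game_val (v : Pos k) (l : List I) :
    (ChamberGame.run (game hk) v l : Pos k).1 = runFire (wt k) v.1 l := by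
  induction l with
  | nil => rfl
  | cons t l ih =>
    change fire (wt k) t (ChamberGame.run (game hk) v l : Pos k).1 = _
    rw [ih]; rfl

theorem legal_of_legalAt (v : Pos k) {l : List I} (h : LegalAt (wt k) v.1 l) :
    ChamberGame.Legal (game hk) v l := by
  induction l with
  | nil => trivial
  | cons t l ih =>
    refine ⟨ih h.1, ?_⟩
    change ¬ (ChamberGame.run (game hk) v l : Pos k).1 t < 0
    rw [run_game_val, not_lt]
    exact h.2.le

/-- A ping-pong table for three palindromic words. -/
structure Cones (c : I → I → ℝ) where
  /-- the words -/
  W : Fin 3 → List I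
  /-- the cones -/
  K : Fin 3 → (I → ℝ) → Prop
  ne_nil : ∀ b, W b ≠ []
  palindrome : ∀ b, (W b).reverse = W b
  base : ∀ b, K b fun _ => 1
  step : ∀ b b', b ≠ b' → ∀ μ, K b' μ → LegalAt c μ (W b) ∧ K b (runFire c μ (W b))

theorem Cones.legalAt {c : I → I → ℝ} (C : Cones c) (L : List (Fin 3))
    (hL : L.IsChain (· ≠ ·)) :
    LegalAt c (fun _ => 1) (L.flatMap C.W) ∧
      ∀ b ∈ L.head?, C.K b (runFire c (fun _ => 1) (L.flatMap C.W)) := by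
  induction L with
  | nil => exact ⟨trivial, by simp⟩
  | cons b L ih =>
    have h : ∃ b', b ≠ b' ∧ C.K b' (runFire c (fun _ => 1) (L.flatMap C.W)) := by
      rcases L with _ | ⟨b', L⟩
      · obtain ⟨b', hb'⟩ := exists_ne b
        exact ⟨b', hb'.symm, C.base b'⟩
      · rw [List.isChain_cons_cons] at hL
        exact ⟨b', hL.1, (ih hL.2).2 b' (by simp)⟩
    obtain ⟨b', hb', hK⟩ := h
    obtain ⟨h₁, h₂⟩ := C.step b b' hb' _ hK
    rw [List.flatMap_cons, legalAt_append, runFire_append]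
    exact ⟨⟨(ih hL.of_cons).1, h₁⟩, by simpa using h₂⟩

end NumbersGame

open NumbersGame ChamberGame in
/-- A non-spherical Pride group contains a free subgroup as soon as its labels allow
a ping-pong table. -/
theorem exists_injective_of_cones {I : Type*} [DecidableEq I] {G : I → Type*} [∀ i, Group (G i)]
    [∀ i, Nontrivial (G i)] {R : ∀ i j : I, Set (Coprod (G i) (G j))} (hR : IsPrideData G R)
    {k : I → I → ℕ} (hk : IsLabelling k)
    (hgirth : ∀ i j, i ≠ j → ∀ l : List (Σ t, G t),
      (∀ x ∈ l, x.1 = i ∨ x.1 = j) → (k i j ≠ 0 → l.length < 2 * k i j) →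
      letterProd l ∈ Subgroup.normalClosure (edgeEmb G i j '' R i j) → letterProd l = 1)
    (C : Cones (wt k)) : ∃ f : FreeGroup (Fin 2) →* PrideGroup G R, Function.Injective f := by
  choose g hg using fun i => exists_ne (1 : G i)
  have hword : ∀ l : List (Σ t, G t), l ≠ [] → (∀ x ∈ l, x.2 ≠ 1) →
      LegalAt (wt k) (fun _ => 1) (l.map Sigma.fst) →
      letterProd l ∉ Subgroup.normalClosure (prideRels G R) := by
    intro l hl hl' hL
    refine letterProd_notMem (game hk) (fun i j => edgeEmb G i j '' R i j) (fun i j => ?_)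
      (fun i j hij r hr => ?_) (fun i j hij h0 => ?_) hgirth (fun i => ?_)
      (⟨fun _ => 1, 0, .zero⟩ : Pos k) hl hl' (legal_of_legalAt hk _ hL)
    · rw [← hR.2.1 i j, Set.image_image]
      simp only [edgeEmb_swap]
    · obtain ⟨x, -, rfl⟩ := hr
      exact exists_letterProd i j x
    · change 2 ≤ k i j
      change k i j ≠ 0 at h0
      have := hk.values i j hij
      omega
    · simp [hR.1]
  let E : Bool → Fin 3 → List (Σ t, G t) := fun s b =>
    (C.W b).map fun t => ⟨t, cond s (g t) (g t)⁻¹⟩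
  have hE : ∀ b, letterProd (E false b) = (letterProd (E true b))⁻¹ := by
    intro b
    simp only [E, letterProd, List.prod_inv_reverse, List.map_map]
    rw [← List.map_reverse, C.palindrome]
    simp [Function.comp_def]
  refine exists_injective_of_words
    (fun b => (letterProd (E true b) : PrideGroup G R)) fun L hL hchain h1 => ?_
  have e : (L.map fun x => cond x.2 (letterProd (E true x.1) : PrideGroup G R)
      (letterProd (E true x.1) : PrideGroup G R)⁻¹).prod =
      (letterProd (L.flatMap fun x => E x.2 x.1) : PrideGroup G R) := by
    clear hL hchain h1
    induction L with
    | nil => rfl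
    | cons x L ih =>
      obtain ⟨b, s⟩ := x
      rw [List.map_cons, List.prod_cons, ih, List.flatMap_cons, letterProd_append]
      cases s
      · simp [hE]
      · simp
  rw [e, QuotientGroup.eq_one_iff] at h1
  refine hword _ ?_ ?_ ?_ h1
  · obtain ⟨x, L, rfl⟩ := List.exists_cons_of_ne_nil hL
    simp [E, C.ne_nil]
  · intro y hy
    simp only [List.mem_flatMap, E, List.mem_map] at hy
    obtain ⟨x, -, t, -, rfl⟩ := hy
    cases x.2
    · simpa using hg t
    · exact hg t
  · have e2 : (L.flatMap fun x => E x.2 x.1).map Sigma.fst = (L.map Prod.fst).flatMap C.W := by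
      clear hL hchain h1 e
      induction L with
      | nil => rfl
      | cons x L ih => simp [E, List.map_flatMap, List.flatMap_map, Function.comp_def]
    rw [e2]
    refine (C.legalAt _ ?_).1
    rwa [List.isChain_map]

namespace NumbersGame

variable {I : Type*} {c : I → I → ℝ}

/-- The entries of the list can be fired in order at positive coordinates, and the result
satisfies `Q`. -/
def Fires (c : I → I → ℝ) (Q : (I → ℝ) → Prop) : List I → (I → ℝ) → Prop
  | [], μ => Q μ
  | t :: l, μ => 0 < μ t ∧ Fires c Q l (fire c t μ)

theorem Fires.legalAt {Q : (I → ℝ) → Prop} {l : List I} {μ : I → ℝ} (h : Fires c Q l μ) :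
    LegalAt c μ l.reverse ∧ Q (runFire c μ l.reverse) := by
  induction l generalizing μ with
  | nil => exact ⟨trivial, h⟩
  | cons t l ih =>
    obtain ⟨h₁, h₂⟩ := ih h.2
    rw [List.reverse_cons, legalAt_append, runFire_append]
    exact ⟨⟨⟨trivial, h.1⟩, h₁⟩, h₂⟩

/-- A ping-pong table from explicit words and cones. -/
theorem nonempty_cones (p q r : List I) (P Q R : (I → ℝ) → Prop)
    (hp : p ≠ [] ∧ p.reverse = p) (hq : q ≠ [] ∧ q.reverse = q) (hr : r ≠ [] ∧ r.reverse = r)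
    (base : P (fun _ => 1) ∧ Q (fun _ => 1) ∧ R (fun _ => 1))
    (hqp : ∀ μ, Q μ → Fires c P p μ) (hrp : ∀ μ, R μ → Fires c P p μ)
    (hpq : ∀ μ, P μ → Fires c Q q μ) (hrq : ∀ μ, R μ → Fires c Q q μ)
    (hpr : ∀ μ, P μ → Fires c R r μ) (hqr : ∀ μ, Q μ → Fires c R r μ) :
    Nonempty (Cones c) := by
  have key : ∀ {X : (I → ℝ) → Prop} {l : List I} {μ}, l.reverse = l → Fires c X l μ →
      LegalAt c μ l ∧ X (runFire c μ l) := fun hl h => by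
    have := h.legalAt
    rwa [hl] at this
  refine ⟨⟨![p, q, r], ![P, Q, R], ?_, ?_, ?_, ?_⟩⟩
  · simp [Fin.forall_fin_succ, hp.1, hq.1, hr.1]
  · simp [Fin.forall_fin_succ, hp.2, hq.2, hr.2]
  · simpa [Fin.forall_fin_succ] using base
  · intro b b' hb μ h
    fin_cases b <;> fin_cases b' <;> first | exact absurd rfl hb | skip
    · exact key hp.2 (hqp μ h)
    · exact key hp.2 (hrp μ h)
    · exact key hq.2 (hpq μ h)
    · exact key hq.2 (hrq μ h)
    · exact key hr.2 (hpr μ h)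
    · exact key hr.2 (hqr μ h)

theorem nonempty_cones_of_two_infinite {x y z : I} (hxy : x ≠ y) (hxz : x ≠ z) (hyz : y ≠ z)
    (hc : ∀ i j, c i j = c j i) (h₁ : c x y = 2) (h₂ : c x z = 2) (h₃ : c y z = 0) :
    Nonempty (Cones c) := by
  have h₁' := (hc y x).trans h₁
  have h₂' := (hc z x).trans h₂
  have h₃' := (hc z y).trans h₃
  refine nonempty_cones [x] [y, x, y] [z, x, z]
    (fun μ => 0 < μ x + μ y ∧ 0 < μ x + μ z ∧ 0 < μ y ∧ 0 < μ z)
    (fun μ => 0 < μ x + μ y ∧ 0 < μ x + μ z ∧ 0 < μ x ∧ 0 < μ z)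
    (fun μ => 0 < μ x + μ y ∧ 0 < μ x + μ z ∧ 0 < μ x ∧ 0 < μ y)
    (by simp) (by simp) (by simp) (by norm_num) ?_ ?_ ?_ ?_ ?_ ?_ <;>
  rintro μ ⟨a₁, a₂, a₃, a₄⟩ <;>
  simp only [Fires, fire, hxy, hxz, hyz, hxy.symm, hxz.symm, hyz.symm, if_true, if_false,
    h₁, h₂, h₃, h₁', h₂', h₃'] <;>
  refine ⟨?_, ?_⟩ <;> (try refine ⟨?_, ?_⟩) <;> (try refine ⟨?_, ?_⟩) <;>
    (try refine ⟨?_, ?_⟩) <;> (try refine ⟨?_, ?_⟩) <;> (try refine ⟨?_, ?_⟩) <;>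
    linarith

theorem fires_cons {Q : (I → ℝ) → Prop} {a b d : I} {l : List I} {μ : I → ℝ} {s t : ℝ}
    (hab : b ≠ a) (had : d ≠ a) (hs : s ≤ c a b) (hs' : c a b ≤ 2) (ht : t ≤ c a d)
    (ht' : c a d ≤ 2) (hpos : 0 < μ a)
    (h : ∀ (ν : I → ℝ) (y z : ℝ), ν a = -μ a → ν b = μ b + y → ν d = μ d + z → s * μ a ≤ y →
      y ≤ 2 * μ a → t * μ a ≤ z → z ≤ 2 * μ a → Fires c Q l ν) : Fires c Q (a :: l) μ :=
  ⟨hpos, h _ _ _ (fire_same ..) (fire_ne c hab μ) (fire_ne c had μ)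
    (mul_le_mul_of_nonneg_right hs hpos.le) (mul_le_mul_of_nonneg_right hs' hpos.le)
    (mul_le_mul_of_nonneg_right ht hpos.le) (mul_le_mul_of_nonneg_right ht' hpos.le)⟩

end NumbersGame

namespace NumbersGame

variable {I : Type*} {c : I → I → ℝ} {a b d : I}

/-- A triple of vertices two of whose bonds have weight at least `1`, and the third at
least `7 / 5`. -/
structure Triangle (c : I → I → ℝ) (a b d : I) : Prop where
  ne_ab : a ≠ b
  ne_bd : b ≠ d
  ne_ad : a ≠ d
  symm : ∀ i j, c i j = c j i
  ab : 1 ≤ c a b ∧ c a b ≤ 2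
  bd : 1 ≤ c b d ∧ c b d ≤ 2
  ad : 7 / 5 ≤ c a d ∧ c a d ≤ 2

theorem Triangle.swap (h : Triangle c a b d) : Triangle c d b a where
  ne_ab := h.ne_bd.symm
  ne_bd := h.ne_ab.symm
  ne_ad := h.ne_ad.symm
  symm := h.symm
  ab := h.symm d b ▸ h.bd
  bd := h.symm b a ▸ h.ab
  ad := h.symm d a ▸ h.ad

theorem Triangle.fires_a (T : Triangle c a b d) {Q : (I → ℝ) → Prop} {l : List I} {μ : I → ℝ}
    (hpos : 0 < μ a)
    (h : ∀ (ν : I → ℝ) (y z : ℝ), ν a = -μ a → ν b = μ b + y → ν d = μ d + z → μ a ≤ y →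
      y ≤ 2 * μ a → 7 / 5 * μ a ≤ z → z ≤ 2 * μ a → Fires c Q l ν) : Fires c Q (a :: l) μ :=
  fires_cons T.ne_ab.symm T.ne_ad.symm T.ab.1 T.ab.2 T.ad.1 T.ad.2 hpos
    fun ν y z h₁ h₂ h₃ h₄ => h ν y z h₁ h₂ h₃ (by linarith)

theorem Triangle.fires_b (T : Triangle c a b d) {Q : (I → ℝ) → Prop} {l : List I} {μ : I → ℝ}
    (hpos : 0 < μ b)
    (h : ∀ (ν : I → ℝ) (y z : ℝ), ν b = -μ b → ν a = μ a + y → ν d = μ d + z → μ b ≤ y →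
      y ≤ 2 * μ b → μ b ≤ z → z ≤ 2 * μ b → Fires c Q l ν) : Fires c Q (b :: l) μ :=
  fires_cons T.ne_ab T.ne_bd.symm (T.symm b a ▸ T.ab.1) (T.symm b a ▸ T.ab.2) T.bd.1 T.bd.2 hpos
    fun ν y z h₁ h₂ h₃ h₄ h₅ h₆ => h ν y z h₁ h₂ h₃ (by linarith) h₅ (by linarith)

/-- The cone attached to the word `[b]`. -/
def coneB (a b d : I) (μ : I → ℝ) : Prop :=
  0 < μ a ∧ 0 < μ d ∧ -(3 / 2) * μ b ≤ μ a + μ d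

/-- The cone attached to the long palindrome starting with `a`. -/
def coneA (a b d : I) (μ : I → ℝ) : Prop :=
  0 < μ b ∧ 0 < μ d ∧ 0 < μ a + μ b ∧ -18 * μ a ≤ 25 * μ d

theorem coneB_swap {μ : I → ℝ} : coneB a b d μ ↔ coneB d b a μ := by
  simp only [coneB, add_comm (μ a)]
  tauto

/-- The long palindrome. -/
def longWord (a b d : I) : List I := [a, d, b, a, d, a, b, a, d, a, b, d, a]

theorem Triangle.fires_b_coneB (T : Triangle c a b d) {μ : I → ℝ} (h : coneA a b d μ) :
    Fires c (coneB a b d) [b] μ := by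
  obtain ⟨h₁, h₂, h₃, h₄⟩ := h
  refine T.fires_b h₁ fun ν y z _ _ _ _ _ _ _ => ?_
  refine ⟨?_, ?_, ?_⟩ <;> linarith

theorem Triangle.fires_longWord (T : Triangle c a b d) {μ : I → ℝ}
    (h : coneB a b d μ ∨ coneA d b a μ) : Fires c (coneA a b d) (longWord a b d) μ := by
  unfold coneB coneA at h
  rcases h with h | h
  all_goals
    refine T.fires_a (by linarith) fun ν0 y0 z0 _ _ _ _ _ _ _ => ?_
    refine T.swap.fires_a (by linarith) fun ν1 y1 z1 _ _ _ _ _ _ _ => ?_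
    refine T.fires_b (by linarith) fun ν2 y2 z2 _ _ _ _ _ _ _ => ?_
    refine T.fires_a (by linarith) fun ν3 y3 z3 _ _ _ _ _ _ _ => ?_
    refine T.swap.fires_a (by linarith) fun ν4 y4 z4 _ _ _ _ _ _ _ => ?_
    refine T.fires_a (by linarith) fun ν5 y5 z5 _ _ _ _ _ _ _ => ?_
    refine T.fires_b (by linarith) fun ν6 y6 z6 _ _ _ _ _ _ _ => ?_
    refine T.fires_a (by linarith) fun ν7 y7 z7 _ _ _ _ _ _ _ => ?_
    refine T.swap.fires_a (by linarith) fun ν8 y8 z8 _ _ _ _ _ _ _ => ?_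
    refine T.fires_a (by linarith) fun ν9 y9 z9 _ _ _ _ _ _ _ => ?_
    refine T.fires_b (by linarith) fun ν10 y10 z10 _ _ _ _ _ _ _ => ?_
    refine T.swap.fires_a (by linarith) fun ν11 y11 z11 _ _ _ _ _ _ _ => ?_
    refine T.fires_a (by linarith) fun ν12 y12 z12 _ _ _ _ _ _ _ => ?_
    refine ⟨?_, ?_, ?_, ?_⟩ <;> linarith

theorem Triangle.nonempty_cones (T : Triangle c a b d) : Nonempty (Cones c) :=
  NumbersGame.nonempty_cones [b] (longWord a b d) (longWord d b a)
    (coneB a b d) (coneA a b d) (coneA d b a)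
    (by simp) (by simp [longWord]) (by simp [longWord]) (by norm_num [coneB, coneA])
    (fun _ => T.fires_b_coneB) (fun _ h => by
      simpa only [Fires, coneB_swap (a := a)] using T.swap.fires_b_coneB h)
    (fun _ h => T.fires_longWord (.inl h)) (fun _ h => T.fires_longWord (.inr h))
    (fun _ h => T.swap.fires_longWord (.inl (coneB_swap.1 h)))
    (fun _ h => T.swap.fires_longWord (.inr h))

end NumbersGame

namespace NumbersGame

variable {I : Type*} {c : I → I → ℝ}

/-- Three vertices `x₁, x₂, x₃` with all mutual weights `1`, and a further vertex `w` bonded to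
each of them. -/
theorem nonempty_cones_of_three_bonds {x₁ x₂ x₃ w : I} (h₁₂ : x₁ ≠ x₂) (h₁₃ : x₁ ≠ x₃)
    (h₂₃ : x₂ ≠ x₃) (h₁ : x₁ ≠ w) (h₂ : x₂ ≠ w) (h₃ : x₃ ≠ w) (hc : ∀ i j, c i j = c j i)
    (c₁₂ : c x₁ x₂ = 1) (c₁₃ : c x₁ x₃ = 1) (c₂₃ : c x₂ x₃ = 1)
    (c₁ : 1 ≤ c x₁ w) (c₂ : 1 ≤ c x₂ w) (c₃ : 1 ≤ c x₃ w) : Nonempty (Cones c) := by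
  have c₂₁ := (hc x₂ x₁).trans c₁₂
  have c₃₁ := (hc x₃ x₁).trans c₁₃
  have c₃₂ := (hc x₃ x₂).trans c₂₃
  have stepw : ∀ {Q : (I → ℝ) → Prop} {l : List I} {μ : I → ℝ}, 0 < μ w →
      (∀ (ν : I → ℝ) (y₁ y₂ y₃ : ℝ), ν w = -μ w → ν x₁ = μ x₁ + y₁ → ν x₂ = μ x₂ + y₂ →
        ν x₃ = μ x₃ + y₃ → μ w ≤ y₁ → μ w ≤ y₂ → μ w ≤ y₃ → Fires c Q l ν) →
      Fires c Q (w :: l) μ := fun hpos h =>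
    ⟨hpos, h _ _ _ _ (fire_same ..) (fire_ne c h₁ _) (fire_ne c h₂ _) (fire_ne c h₃ _)
      (le_mul_of_one_le_left hpos.le (hc x₁ w ▸ c₁))
      (le_mul_of_one_le_left hpos.le (hc x₂ w ▸ c₂))
      (le_mul_of_one_le_left hpos.le (hc x₃ w ▸ c₃))⟩
  have step : ∀ a b d : I, b ≠ a → d ≠ a → a ≠ w → c a b = 1 → c a d = 1 → 1 ≤ c a w →
      ∀ (Q : (I → ℝ) → Prop) (l : List I) (μ : I → ℝ), 0 < μ a →
      (∀ (ν : I → ℝ) (y : ℝ), ν a = -μ a → ν b = μ b + μ a → ν d = μ d + μ a →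
        ν w = μ w + y → μ a ≤ y → Fires c Q l ν) → Fires c Q (a :: l) μ :=
    fun a b d hb hd hw eb ed ew Q l μ hpos h =>
    ⟨hpos, h _ _ (fire_same ..) (by rw [fire_ne c hb, eb, one_mul])
      (by rw [fire_ne c hd, ed, one_mul]) (fire_ne c hw.symm _)
      (le_mul_of_one_le_left hpos.le ew)⟩
  have fire₁ := step x₁ x₂ x₃ (h₁₂.symm) (h₁₃.symm) h₁ c₁₂ c₁₃ c₁
  have fire₂ := step x₂ x₁ x₃ h₁₂ h₂₃.symm h₂ c₂₁ c₂₃ c₂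
  have fire₃ := step x₃ x₁ x₂ h₁₃ h₂₃ h₃ c₃₁ c₃₂ c₃
  refine nonempty_cones [x₁] [x₂, x₃, x₂] [w, x₂, x₃, x₂, w]
    (fun μ => 0 < μ x₂ ∧ 0 < μ x₃ ∧ 0 < μ x₁ + μ x₂ + μ x₃ ∧ 0 < μ w)
    (fun μ => (0 < μ x₁ ∧ 0 < μ x₁ + μ x₂ ∧ 0 < μ x₁ + μ x₃ ∧ 0 < μ x₁ + μ x₂ + μ x₃) ∧
      0 < μ w ∧ 0 < μ w + μ x₂ ∧ 0 < μ w + μ x₃ ∧ 0 < μ w + μ x₂ + μ x₃)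
    (fun μ => 0 < μ x₂ ∧ 0 < μ x₃ ∧ 0 < μ w + μ x₂ + μ x₃ ∧ 0 < μ x₁ ∧ 0 < μ x₁ + μ w)
    (by simp) (by simp) (by simp) (by norm_num) ?_ ?_ ?_ ?_ ?_ ?_
  · rintro μ ⟨⟨_, _, _, _⟩, _, _, _, _⟩
    refine fire₁ _ _ _ (by linarith) fun ν0 y0 _ _ _ _ _ => ?_
    refine ⟨?_, ?_, ?_, ?_⟩ <;> linarith
  · rintro μ ⟨_, _, _, _, _⟩
    refine fire₁ _ _ _ (by linarith) fun ν0 y0 _ _ _ _ _ => ?_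
    refine ⟨?_, ?_, ?_, ?_⟩ <;> linarith
  · rintro μ ⟨_, _, _, _⟩
    refine fire₂ _ _ _ (by linarith) fun ν0 y0 _ _ _ _ _ => ?_
    refine fire₃ _ _ _ (by linarith) fun ν1 y1 _ _ _ _ _ => ?_
    refine fire₂ _ _ _ (by linarith) fun ν2 y2 _ _ _ _ _ => ?_
    refine ⟨⟨?_, ?_, ?_, ?_⟩, ?_, ?_, ?_, ?_⟩ <;> linarith
  · rintro μ ⟨_, _, _, _, _⟩
    refine fire₂ _ _ _ (by linarith) fun ν0 y0 _ _ _ _ _ => ?_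
    refine fire₃ _ _ _ (by linarith) fun ν1 y1 _ _ _ _ _ => ?_
    refine fire₂ _ _ _ (by linarith) fun ν2 y2 _ _ _ _ _ => ?_
    refine ⟨⟨?_, ?_, ?_, ?_⟩, ?_, ?_, ?_, ?_⟩ <;> linarith
  · rintro μ ⟨_, _, _, _⟩
    refine stepw (by linarith) fun ν0 y0 z0 u0 _ _ _ _ _ _ _ => ?_
    refine fire₂ _ _ _ (by linarith) fun ν1 y1 _ _ _ _ _ => ?_
    refine fire₃ _ _ _ (by linarith) fun ν2 y2 _ _ _ _ _ => ?_
    refine fire₂ _ _ _ (by linarith) fun ν3 y3 _ _ _ _ _ => ?_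
    refine stepw (by linarith) fun ν4 y4 z4 u4 _ _ _ _ _ _ _ => ?_
    refine ⟨?_, ?_, ?_, ?_, ?_⟩ <;> linarith
  · rintro μ ⟨⟨_, _, _, _⟩, _, _, _, _⟩
    refine stepw (by linarith) fun ν0 y0 z0 u0 _ _ _ _ _ _ _ => ?_
    refine fire₂ _ _ _ (by linarith) fun ν1 y1 _ _ _ _ _ => ?_
    refine fire₃ _ _ _ (by linarith) fun ν2 y2 _ _ _ _ _ => ?_
    refine fire₂ _ _ _ (by linarith) fun ν3 y3 _ _ _ _ _ => ?_
    refine stepw (by linarith) fun ν4 y4 z4 u4 _ _ _ _ _ _ _ => ?_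
    refine ⟨?_, ?_, ?_, ?_, ?_⟩ <;> linarith

end NumbersGame

namespace NumbersGame

variable {I : Type*} {k : I → I → ℕ} {x y z : I}

theorem IsLabelling.wt_bounds (hk : IsLabelling k) (h : x ≠ y) (h₂ : k x y ≠ 2)
    : 1 ≤ wt k x y ∧ wt k x y ≤ 2 := by
  have := sqrt_two_bounds
  have := sqrt_three_bounds
  rcases hk.values x y h with e | e | e | e | e <;> simp_all [wt, weight]

theorem IsLabelling.wt_bounds_of_ne_three (hk : IsLabelling k) (h : x ≠ y) (h₂ : k x y ≠ 2) (h₃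
    : k x y ≠ 3) :
    7 / 5 ≤ wt k x y ∧ wt k x y ≤ 2 := by
  have := sqrt_two_bounds
  have := sqrt_three_bounds
  rcases hk.values x y h with e | e | e | e | e <;> simp_all [wt, weight] <;>
    linarith

theorem IsLabelling.eq_zero (hk : IsLabelling k) (hxy : x ≠ y) (hyz : y ≠ z) (hxz : x ≠ z) (h₁
    : k x y = 2)
    (h₂ : k y z = 2) : k x z = 0 := by
  have := hk.triple x y z hxy hyz hxz
  rw [h₁, h₂] at this
  rcases hk.values x z hxz with e | e | e | e | e <;> rw [e] at this ⊢ <;> norm_num at this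

theorem IsLabelling.ne_two_three (hk : IsLabelling k) (hxy : x ≠ y) (hyz : y ≠ z) (hxz : x ≠ z)
    (h₁ : k x y = 2)
    (h₂ : k y z = 3) : k x z ≠ 2 ∧ k x z ≠ 3 := by
  have := hk.triple x y z hxy hyz hxz
  rw [h₁, h₂] at this
  constructor <;> intro e <;> rw [e] at this <;> norm_num at this

theorem IsLabelling.triangle (hk : IsLabelling k) (hxy : x ≠ y) (hyz : y ≠ z) (hxz : x ≠ z) (h₁
    : k x y ≠ 2)
    (h₂ : k y z ≠ 2) (h₃ : k x z ≠ 2) (h₄ : k x z ≠ 3) : Triangle (wt k) x y z where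
  ne_ab := hxy
  ne_bd := hyz
  ne_ad := hxz
  symm := wt_comm hk
  ab := hk.wt_bounds hxy h₁
  bd := hk.wt_bounds hyz h₂
  ad := hk.wt_bounds_of_ne_three hxz h₃ h₄

/-- Three pairwise non-commuting vertices, together with a fourth vertex. -/
theorem IsLabelling.nonempty_cones_of_independent (hk : IsLabelling k) {w : I} (hxy : x ≠ y) (hyz
    : y ≠ z)
    (hxz : x ≠ z) (hx : x ≠ w) (hy : y ≠ w) (hz : z ≠ w)
    (h₁ : k x y ≠ 2) (h₂ : k y z ≠ 2) (h₃ : k x z ≠ 2) : Nonempty (Cones (wt k)) := by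
  by_cases e₃ : k x z = 3
  swap
  · exact (hk.triangle hxy hyz hxz h₁ h₂ h₃ e₃).nonempty_cones
  by_cases e₁ : k x y = 3
  swap
  · exact (hk.triangle hxz hyz.symm hxy h₃ (hk.symm y z ▸ h₂) h₁ e₁).nonempty_cones
  by_cases e₂ : k y z = 3
  swap
  · exact (hk.triangle hxy.symm hxz hyz (hk.symm x y ▸ h₁) h₃ h₂ e₂).nonempty_cones
  have key : ∀ a b d : I, a ≠ b → b ≠ d → a ≠ d → a ≠ w → b ≠ w → d ≠ w →
      k a b = 3 → k b d = 3 → k a d = 3 → k a w = 2 → Nonempty (Cones (wt k)) := by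
    intro a b d hab hbd had ha hb hd eab ebd ead ew
    rw [hk.symm] at ew
    obtain ⟨b₁, b₂⟩ := hk.ne_two_three ha.symm hab hb.symm ew eab
    obtain ⟨d₁, -⟩ := hk.ne_two_three ha.symm had hd.symm ew ead
    exact (hk.triangle hd.symm hbd.symm hb.symm d₁ (by rw [hk.symm, ebd]; norm_num)
      b₁ b₂).nonempty_cones
  by_cases wx : k x w = 2
  · exact key x y z hxy hyz hxz hx hy hz e₁ e₂ e₃ wx
  by_cases wy : k y w = 2
  · exact key y x z hxy.symm hxz hyz hy hx hz (hk.symm x y ▸ e₁) e₃ e₂ wy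
  by_cases wz : k z w = 2
  · exact key z y x hyz.symm hxy.symm hxz.symm hz hy hx (hk.symm y z ▸ e₂) (hk.symm x y ▸ e₁)
      (hk.symm x z ▸ e₃) wz
  exact nonempty_cones_of_three_bonds hxy hxz hyz hx hy hz (wt_comm hk) (by simp [wt, weight, e₁])
    (by simp [wt, weight, e₃]) (by simp [wt, weight, e₂]) (hk.wt_bounds hx wx).1
    (hk.wt_bounds hy wy).1
    (hk.wt_bounds hz wz).1

/-- If any three vertices contain a commuting pair and a vertex `v` commutes with `x` and `y`,
but not with `p` and `q`, then the commutation graph on these vertices is a pentagon. -/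
theorem IsLabelling.nonempty_cones_of_pentagon (hk : IsLabelling k) {v p q : I} (h
    : [v, x, y, p, q].Nodup)
    (H : ∀ a b d, a ≠ b → b ≠ d → a ≠ d → k a b = 2 ∨ k b d = 2 ∨ k a d = 2)
    (hx : k v x = 2) (hy : k v y = 2) (hp : k v p ≠ 2) (hq : k v q ≠ 2) :
    Nonempty (Cones (wt k)) := by
  simp only [List.nodup_cons, List.mem_cons, List.not_mem_nil, not_or, or_false, ← ne_eq] at h
  obtain ⟨⟨vx, vy, vp, vq⟩, ⟨xy, xp, xq⟩, ⟨yp, yq⟩, pq, -⟩ := h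
  have epq : k p q = 2 := by have := H v p q vp pq vq; tauto
  have exy := hk.eq_zero vx.symm vy xy (hk.symm v x ▸ hx) hy
  have side : ∀ s t : I, s ≠ t → s ≠ p → s ≠ q → t ≠ q → v ≠ s → v ≠ t → k v s = 2 →
      k s t = 0 → k s p = 2 → Nonempty (Cones (wt k)) := by
    intro s t st sp sq tq vs vt hs est esp
    have esq := hk.eq_zero sp pq sq esp epq
    have etq : k t q = 2 := by have := H s t q st tq sq; omega
    exact nonempty_cones_of_two_infinite st sq tq (wt_comm hk) (by simp [wt, weight, est])
      (by simp [wt, weight, esq]) (by simp [wt, weight, etq])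
  rcases H x y p xy yp xp with e | e | e
  · omega
  · exact side y x xy.symm yp yq xq vy vx hy (hk.symm x y ▸ exy) e
  · exact side x y xy xp xq yq vx vy hx exy e

theorem IsLabelling.nonempty_cones (hk : IsLabelling k) [Fintype I] (hI : 5 ≤ Fintype.card I) :
    Nonempty (Cones (wt k)) := by
  classical
  by_cases H : ∀ a b d, a ≠ b → b ≠ d → a ≠ d → k a b = 2 ∨ k b d = 2 ∨ k a d = 2
  swap
  · push Not at H
    obtain ⟨a, b, d, hab, hbd, had, h₁, h₂, h₃⟩ := H
    obtain ⟨w, hw⟩ : ∃ w, w ∉ ({a, b, d} : Finset I) := by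
      by_contra! h
      have := (Finset.card_le_card (s := .univ) fun w _ => h w).trans Finset.card_le_three
      rw [Finset.card_univ] at this
      omega
    simp only [Finset.mem_insert, Finset.mem_singleton, not_or] at hw
    exact hk.nonempty_cones_of_independent hab hbd had (Ne.symm hw.1) (Ne.symm hw.2.1)
      (Ne.symm hw.2.2) h₁ h₂ h₃
  have notri : ∀ a b d, a ≠ b → b ≠ d → a ≠ d → k a b = 2 → k b d = 2 → k a d ≠ 2 :=
    fun a b d h₁ h₂ h₃ e₁ e₂ => by simp [hk.eq_zero h₁ h₂ h₃ e₁ e₂]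
  have three : ∀ v a b d, [v, a, b, d].Nodup → ¬ (k v a = 2 ↔ k v b = 2) ∨
      ¬ (k v a = 2 ↔ k v d = 2) := by
    intro v a b d h
    simp only [List.nodup_cons, List.mem_cons, List.not_mem_nil, not_or, or_false, ← ne_eq] at h
    obtain ⟨⟨va, vb, vd⟩, ⟨ab, ad⟩, bd, -⟩ := h
    have := H a b d ab bd ad
    have := notri a b d ab bd ad
    have := H v a b va ab vb
    have := notri v a b va ab vb
    have := H v a d va ad vd
    have := notri v a d va ad vd
    have := H v b d vb bd vd
    have := notri v b d vb bd vd
    grind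
  obtain ⟨f⟩ : Nonempty (Fin 5 ↪ I) := Function.Embedding.nonempty_of_card_le (by simpa)
  have nd : ∀ l : List (Fin 5), l.Nodup → (l.map f).Nodup := fun l =>
    (List.nodup_map_iff f.injective).2
  have t₁ := three (f 0) (f 1) (f 2) (f 3) (nd [0, 1, 2, 3] (by decide))
  have t₂ := three (f 0) (f 1) (f 2) (f 4) (nd [0, 1, 2, 4] (by decide))
  have t₃ := three (f 0) (f 1) (f 3) (f 4) (nd [0, 1, 3, 4] (by decide))
  have t₄ := three (f 0) (f 2) (f 3) (f 4) (nd [0, 2, 3, 4] (by decide))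
  have pent := fun (x y p q : Fin 5) (h : [0, x, y, p, q].Nodup) =>
    hk.nonempty_cones_of_pentagon (nd [0, x, y, p, q] h) H
  have p₁ := pent 1 2 3 4 (by decide)
  have p₂ := pent 1 3 2 4 (by decide)
  have p₃ := pent 1 4 2 3 (by decide)
  have p₄ := pent 2 3 1 4 (by decide)
  have p₅ := pent 2 4 1 3 (by decide)
  have p₆ := pent 3 4 1 2 (by decide)
  grind

end NumbersGame


/-- Every non-spherical Pride group based on a complete graph with at
least 5 vertices contains a non-abelian free subgroup. -/
theorem pride_group_five_vertices_contains_free_subgroup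
    {I : Type*} [Fintype I] (hI : 5 ≤ Fintype.card I)
    (G : I → Type*) [∀ i, Group (G i)] (hG : ∀ i, Nontrivial (G i))
    (R : ∀ i j : I, Set (Coprod (G i) (G j)))
    (hR : IsPrideData G R) (hNS : NonSpherical G R) :
    ∃ f : FreeGroup (Fin 2) →* PrideGroup G R, Function.Injective f := by
  classical
  have := hG
  obtain ⟨k, hk, hgirth⟩ := exists_labelling hR hNS
  obtain ⟨C⟩ := hk.nonempty_cones hI
  exact exists_injective_of_cones hR hk hgirth C
end

section
/- Let a, b, c be real numbers, each of which is either 0 or equal to 2π/m for some even integer m ≥ 4. If a + b + c = π, then the multiset {a, b, c} is one of the following four: {π/2, π/2, 0}, {π/2, π/3, π/6}, {π/2, π/4, π/4}, {π/3, π/3, π/3}. -/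
open Real

/-- An angle `2π/m` with `m ≥ 4` even that is at least `π/4` is `π/2`, `π/3` or `π/4`. -/
lemma even_angle_eq_of_pi_div_four_le {x : ℝ}
    (hx : x = 0 ∨ ∃ m : ℕ, Even m ∧ 4 ≤ m ∧ x = 2 * π / m) (h : π / 4 ≤ x) :
    x = π / 2 ∨ x = π / 3 ∨ x = π / 4 := by
  have hpi := pi_pos
  obtain rfl | ⟨m, ⟨k, rfl⟩, hm, rfl⟩ := hx
  · linarith
  · have hk : (0 : ℝ) < ((k + k : ℕ) : ℝ) := by exact_mod_cast (by lia : 0 < k + k)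
    rw [le_div_iff₀ hk] at h
    have hle : ((k + k : ℕ) : ℝ) ≤ 8 := by nlinarith
    have hle' : k + k ≤ 8 := by exact_mod_cast hle
    obtain rfl | rfl | rfl : k = 2 ∨ k = 3 ∨ k = 4 := by lia
    · left; push_cast; ring
    · right; left; push_cast; ring
    · right; right; push_cast; ring

/-- In a decreasing triple with sum `π`, the conditions on the two largest angles determine
the triple up to four possibilities. -/
lemma angle_triples_summing_to_pi_of_le {a b c : ℝ}
    (ha : a = 0 ∨ ∃ m : ℕ, Even m ∧ 4 ≤ m ∧ a = 2 * π / m)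
    (hb : b = 0 ∨ ∃ m : ℕ, Even m ∧ 4 ≤ m ∧ b = 2 * π / m)
    (habc : a + b + c = π) (hba : b ≤ a) (hcb : c ≤ b) :
    ({a, b, c} : Multiset ℝ) = {π / 2, π / 2, 0} ∨
    ({a, b, c} : Multiset ℝ) = {π / 2, π / 3, π / 6} ∨
    ({a, b, c} : Multiset ℝ) = {π / 2, π / 4, π / 4} ∨
    ({a, b, c} : Multiset ℝ) = {π / 3, π / 3, π / 3} := by
  have hpi := pi_pos
  have ha' := even_angle_eq_of_pi_div_four_le ha (by linarith)
  have ha2 : a ≤ π / 2 := by rcases ha' with h | h | h <;> linarith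
  have hb' := even_angle_eq_of_pi_div_four_le hb (by linarith)
  obtain rfl : c = π - a - b := by linarith
  rcases ha' with rfl | rfl | rfl <;> rcases hb' with rfl | rfl | rfl <;> try linarith
  · left; congr 3; ring
  · right; left; congr 3; ring
  · right; right; left; congr 3; ring
  · right; right; right; congr 3; ring

/-- If each of `a`, `b`, `c` is either `0` or of the form `2π/m` for
some even integer `m ≥ 4`, and `a + b + c = π`, then as a multiset `{a, b, c}` is one of
`{π/2, π/2, 0}`, `{π/2, π/3, π/6}`, `{π/2, π/4, π/4}`, `{π/3, π/3, π/3}`. -/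
theorem angle_triples_summing_to_pi
    (a b c : ℝ)
    (ha : a = 0 ∨ ∃ m : ℕ, Even m ∧ 4 ≤ m ∧ a = 2 * π / m)
    (hb : b = 0 ∨ ∃ m : ℕ, Even m ∧ 4 ≤ m ∧ b = 2 * π / m)
    (hc : c = 0 ∨ ∃ m : ℕ, Even m ∧ 4 ≤ m ∧ c = 2 * π / m)
    (habc : a + b + c = π) :
    ({a, b, c} : Multiset ℝ) = {π / 2, π / 2, 0} ∨
    ({a, b, c} : Multiset ℝ) = {π / 2, π / 3, π / 6} ∨
    ({a, b, c} : Multiset ℝ) = {π / 2, π / 4, π / 4} ∨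
    ({a, b, c} : Multiset ℝ) = {π / 3, π / 3, π / 3} := by
  have swap_left (x y z : ℝ) : ({x, y, z} : Multiset ℝ) = {y, x, z} := Multiset.cons_swap x y {z}
  have swap_right (x y z : ℝ) : ({x, y, z} : Multiset ℝ) = {x, z, y} :=
    congrArg (x ::ₘ ·) (Multiset.pair_comm y z)
  rcases le_total a b with hab | hba <;> rcases le_total b c with hbc | hcb <;>
    rcases le_total a c with hac | hca
  · rw [swap_left a b c, swap_right b a c, swap_left b c a]
    exact angle_triples_summing_to_pi_of_le hc hb (by linarith) hbc hab
  · rw [swap_left a b c, swap_right b a c, swap_left b c a]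
    exact angle_triples_summing_to_pi_of_le hc hb (by linarith) hbc hab
  · rw [swap_left a b c, swap_right b a c]
    exact angle_triples_summing_to_pi_of_le hb hc (by linarith) hcb hac
  · rw [swap_left a b c]
    exact angle_triples_summing_to_pi_of_le hb ha (by linarith) hab hca
  · rw [swap_right a b c, swap_left a c b]
    exact angle_triples_summing_to_pi_of_le hc ha (by linarith) hac hba
  · rw [swap_right a b c]
    exact angle_triples_summing_to_pi_of_le ha hc (by linarith) hca hbc
  · exact angle_triples_summing_to_pi_of_le ha hb habc hba hcb
  · exact angle_triples_summing_to_pi_of_le ha hb habc hba hcb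
end

section
/- There is no set M of 2-element subsets of a 5-element set V with the property that every 3-element subset of V contains exactly one member of M. (Equivalently: the edges of the complete graph on 5 vertices cannot be labeled with values π/2 and 0 so that every triangle has exactly two edges labeled π/2 and one edge labeled 0.) -/
/-- Every pair in `Fin 5` lies in exactly three triples. -/
lemma card_triples_containing_pair (e : Finset (Fin 5)) (he : e.card = 2) :
    (((Finset.univ : Finset (Fin 5)).powersetCard 3).filter (e ⊆ ·)).card = 3 := by
  revert e
  decide

/-- No family of pairs in `Fin 5` has exactly one member in each triple: counting incidences
would make `10` a multiple of `3`. -/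
lemma not_forall_triple_card_pairs_eq_one (M : Finset (Finset (Fin 5)))
    (hM : ∀ e ∈ M, e.card = 2) :
    ¬ ∀ T : Finset (Fin 5), T.card = 3 → (M.filter (· ⊆ T)).card = 1 := by
  intro h
  have key := Finset.card_mul_eq_card_mul (s := M)
    (t := (Finset.univ : Finset (Fin 5)).powersetCard 3) (m := 3) (n := 1)
    (fun e T : Finset (Fin 5) => e ⊆ T)
    (fun e he => card_triples_containing_pair e (hM e he))
    (fun T hT => h T (Finset.mem_powersetCard.1 hT).2)
  rw [Finset.card_powersetCard, Finset.card_univ, Fintype.card_fin,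
    show Nat.choose 5 3 = 10 from rfl] at key
  omega

/-- There is no set `M` of `2`-element subsets of a `5`-element set `V`
such that every `3`-element subset of `V` contains exactly one member of `M`. -/
theorem no_perfect_triangle_covering_on_five_points
    (V : Type*) [Fintype V] (hV : Fintype.card V = 5) :
    ¬ ∃ M : Set (Set V), (∀ e ∈ M, e.ncard = 2) ∧
        ∀ T : Set V, T.ncard = 3 → ∃! e, e ∈ M ∧ e ⊆ T := by
  classical
  rintro ⟨M, hM, h⟩
  let f : Fin 5 ≃ V := (Fintype.equivFinOfCardEq hV).symm
  have card_image (s : Finset (Fin 5)) : (f '' (s : Set (Fin 5))).ncard = s.card := by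
    rw [Set.ncard_image_of_injective _ f.injective, Set.ncard_coe_finset]
  refine not_forall_triple_card_pairs_eq_one
    (Finset.univ.filter fun s => f '' (s : Set (Fin 5)) ∈ M) (fun e he => ?_) fun T hT => ?_
  · rw [← card_image]
    exact hM _ (Finset.mem_filter.1 he).2
  · obtain ⟨e, ⟨heM, heT⟩, huniq⟩ := h (f '' (T : Set (Fin 5))) (by rw [card_image, hT])
    have image_preimage : f '' ((f ⁻¹' e).toFinset : Set (Fin 5)) = e := by
      rw [Set.coe_toFinset, f.image_preimage]
    refine Finset.card_eq_one.2 ⟨(f ⁻¹' e).toFinset, Finset.eq_singleton_iff_unique_mem.2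
      ⟨?_, fun s hs => ?_⟩⟩
    · simp only [Finset.mem_filter, Finset.mem_univ, true_and, image_preimage]
      refine ⟨heM, ?_⟩
      rwa [← Finset.coe_subset, ← Set.image_subset_image_iff f.injective, image_preimage]
    · simp only [Finset.mem_filter, Finset.mem_univ, true_and] at hs
      have hse := huniq _ ⟨hs.1, Set.image_mono (Finset.coe_subset.2 hs.2)⟩
      rw [← Finset.coe_inj, ← f.injective.image_injective.eq_iff, image_preimage, hse]
end
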